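/- arXiv:1009.0148 — 2 statements merged into one kernel-verified Lean document; each statement's English description precedes it below -/
import Mathlib

section
/- Let F be an ordinary differential field of characteristic zero, E a differential field extension of F, and ξ = (ξ_1,…,ξ_n) ∈ E^n of differential dimension d and order h over F. For each i ∈ {0,…,d} fix natural numbers s_i ≥ 0 and m_i ≥ 1, let M_i be the set of exponent vectors α = (α_{jk})_{1≤j≤n, 0≤k≤s_i} with 1 ≤ |α| ≤ m_i, and write ξ^α = Π_{j,k} (δ^k ξ_j)^{α_{jk}}. Let the combined family (u_{iα})_{0≤i≤d, α∈M_i} of elements of E be differentially independent over F⟨ξ_1,…,ξ_n⟩, set ζ_i = −Σ_{α∈M_i} u_{iα} ξ^α, and let K = F⟨u_{iα} : all i, α⟩. Put s = s_0 + s_1 + ⋯ + s_d. Then for each i ∈ {0,…,d}, the transcendence degree of the field K⟨ζ_0,…,ζ_d⟩ over the field K⟨ζ_j : j ≠ i⟩ equals h + s − s_i. (This expresses that the generalized differential Chow form g of the variety with generic point ξ, formed with generic differential polynomials of orders s_0,…,s_d and degrees m_0,…,m_d, satisfies ord(g, u_{i0}) = h + s − s_i.) -/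
set_option synthInstance.maxHeartbeats 1000000
set_option maxHeartbeats 1000000

open Cardinal in
/-- The transcendence degree of an algebra `L` over `K`: the supremum of the
cardinalities of algebraically independent subsets of `L` over `K`. -/
noncomputable def Trdeg (K L : Type*) [CommRing K] [CommRing L] [Algebra K L] : Cardinal :=
  ⨆ s : { s : Set L // AlgebraicIndependent K ((↑) : s → L) }, #s.1

/-- A family `a : ι → E` is differentially independent over a subfield `K` of `E`
(w.r.t. a derivation `δ`) if the family of all its iterated derivatives is
algebraically independent over `K`. -/
def DiffIndep {E : Type*} [Field E] (δ : E → E) (K : Subfield E)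
    {ι : Type*} (a : ι → E) : Prop :=
  AlgebraicIndependent K (fun p : ι × ℕ => δ^[p.2] (a p.1))

/-- The differential subfield `F⟨S⟩` of `E` generated by `F` and `S`. -/
def diffAdjoin {E : Type*} [Field E] (δ : E → E) (F : Subfield E) (S : Set E) : Subfield E :=
  Subfield.closure (↑F ∪ {x | ∃ s ∈ S, ∃ k : ℕ, δ^[k] s = x})

/-- `ξ ∈ Eⁿ` has differential dimension `d` and order `h` over `F`: for all sufficiently
large `t`, the transcendence degree over `F` of `F(δʲξᵢ : 1 ≤ i ≤ n, 0 ≤ j ≤ t)`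
equals `d(t+1) + h`. -/
def HasDimOrder {E : Type*} [Field E] (δ : E → E) (F : Subfield E)
    {n : ℕ} (ξ : Fin n → E) (d h : ℕ) : Prop :=
  ∃ T : ℕ, ∀ t : ℕ, T ≤ t →
    Trdeg F (IntermediateField.adjoin F {x : E | ∃ i : Fin n, ∃ j ≤ t, δ^[j] (ξ i) = x})
      = ((d * (t + 1) + h : ℕ) : Cardinal)

/-- The set of exponent vectors `α = (α_{jk})_{1≤j≤n, 0≤k≤s}` of nonnegative integers
with `1 ≤ |α| ≤ m`. -/
abbrev GenMon (n s m : ℕ) : Type :=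
  {α : Fin n × Fin (s + 1) → Fin (m + 1) //
    1 ≤ ∑ p : Fin n × Fin (s + 1), ((α p : ℕ)) ∧ ∑ p : Fin n × Fin (s + 1), ((α p : ℕ)) ≤ m}

/-- The monomial value `ξ^α = ∏_{j,k} (δᵏ ξⱼ)^{α_{jk}}`. -/
noncomputable def monValue {E : Type*} [Field E] (δ : E → E) {n : ℕ} (s m : ℕ)
    (ξ : Fin n → E) (α : GenMon n s m) : E :=
  ∏ p : Fin n × Fin (s + 1), (δ^[(p.2 : ℕ)] (ξ p.1)) ^ ((α.1 p : ℕ))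

/-- The relative algebraic closure in `E` of the subfield generated by a set. -/
def algClosureOf {E : Type*} [Field E] (S : Set E) : Set E :=
  {x | IsAlgebraic (Subfield.closure S) x}

section AlgClosureOf

variable {E : Type*} [Field E]

theorem isAlgebraic_mono {k l : Subfield E} (h : k ≤ l) {x : E} (hx : IsAlgebraic k x) :
    IsAlgebraic l x := by
  let _ : Algebra k l := (Subfield.inclusion h).toAlgebra
  have _ : IsScalarTower k l E := IsScalarTower.of_algebraMap_eq fun _ => rfl
  exact hx.tower_top l

theorem algClosureOf_mono {S T : Set E} (h : S ⊆ T) : algClosureOf S ⊆ algClosureOf T :=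
  fun _ hx => isAlgebraic_mono (Subfield.closure_mono h) hx

theorem closure_subset_algClosureOf (S : Set E) :
    (Subfield.closure S : Set E) ⊆ algClosureOf S :=
  fun x hx => isAlgebraic_algebraMap (⟨x, hx⟩ : Subfield.closure S)

theorem subset_algClosureOf (S : Set E) : S ⊆ algClosureOf S :=
  Subfield.subset_closure.trans (closure_subset_algClosureOf S)

/-- The relative algebraic closure of a set, as a subfield. -/
noncomputable def algClosureSubfield (S : Set E) : Subfield E :=
  (algebraicClosure (Subfield.closure S) E).toSubfield

theorem coe_algClosureSubfield (S : Set E) :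
    (algClosureSubfield S : Set E) = algClosureOf S := by
  ext x
  change x ∈ algebraicClosure (Subfield.closure S) E ↔ _
  exact mem_algebraicClosure_iff

theorem isAlgebraic_algClosureSubfield {S : Set E} {x : E}
    (hx : IsAlgebraic (algClosureSubfield S) x) : x ∈ algClosureOf S := by
  have h : IsAlgebraic (algebraicClosure (Subfield.closure S) E) x := hx
  exact h.restrictScalars (Subfield.closure S)

theorem algClosureOf_subset {S T : Set E} (h : S ⊆ algClosureOf T) :
    algClosureOf S ⊆ algClosureOf T := fun x hx => by
  refine isAlgebraic_algClosureSubfield (isAlgebraic_mono ?_ hx)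
  exact Subfield.closure_le.2 (h.trans (coe_algClosureSubfield T).superset)

theorem adjoin_toSubfield_eq_closure (k : Subfield E) (S : Set E) :
    (IntermediateField.adjoin k S).toSubfield = Subfield.closure (↑k ∪ S) := by
  rw [IntermediateField.adjoin_toSubfield]
  congr 2
  ext x
  exact ⟨fun ⟨y, hy⟩ => hy ▸ y.2, fun hx => ⟨⟨x, hx⟩, rfl⟩⟩

theorem isAlgebraic_adjoin_iff_mem (k : Subfield E) (S : Set E) (x : E) :
    IsAlgebraic (Algebra.adjoin k S) x ↔ x ∈ algClosureOf (↑k ∪ S) := by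
  rw [← IntermediateField.isAlgebraic_adjoin_iff (F := k)]
  change IsAlgebraic (IntermediateField.adjoin k S).toSubfield x ↔ _
  rw [adjoin_toSubfield_eq_closure]
  rfl

theorem matroid_closure_eq_algClosureOf (k : Subfield E) (S : Set E) :
    (AlgebraicIndependent.matroid k E).closure S = algClosureOf (↑k ∪ S) := by
  rw [AlgebraicIndependent.matroid_closure_eq]
  ext x
  exact isAlgebraic_adjoin_iff_mem k S x

/-- Algebraic independence of a family in terms of relative algebraic closures of its parts that
precede a given element, for a rank function with values in `ℕ`. -/
theorem algebraicIndependent_of_rank {ι : Type*} (k : Subfield E) (x : ι → E) (f : ι → ℕ)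
    (h : ∀ i, x i ∉ algClosureOf (↑k ∪ x '' {j | j ≠ i ∧ f j ≤ f i})) :
    AlgebraicIndependent k x := by
  classical
  have key : ∀ t : Finset ι, AlgebraicIndepOn k x (t : Set ι) := by
    intro t
    induction t using Finset.induction_on_max_value f with
    | empty =>
      simpa [AlgebraicIndepOn] using (algebraMap k E).injective
    | insert a s ha hmax ih =>
      rw [Finset.coe_insert]
      refine ih.insert fun hx => h a ?_
      rw [isAlgebraic_adjoin_iff_mem] at hx
      refine algClosureOf_mono (Set.union_subset_union_right _ (Set.image_mono ?_)) hx
      exact fun j hj => ⟨fun e => ha (e ▸ hj), hmax j hj⟩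
  refine algebraicIndependent_of_finite_type fun t ht => ?_
  simpa using key ht.toFinset

theorem algebraicIndependent_iff_notMem_algClosureOf {ι : Type*} (k : Subfield E) (x : ι → E) :
    AlgebraicIndependent k x ↔ ∀ i, x i ∉ algClosureOf (↑k ∪ x '' {i}ᶜ) := by
  constructor
  · intro h i hi
    rw [← isAlgebraic_adjoin_iff_mem] at hi
    exact h.transcendental_adjoin (by simp) hi
  · intro h
    refine algebraicIndependent_of_rank k x 0 fun i hi => h i ?_
    refine algClosureOf_mono (Set.union_subset_union_right _ (Set.image_mono ?_)) hi
    exact fun j hj => hj.1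

end AlgClosureOf

section DerivationClosure

variable {E : Type*} [Field E]

/-- The subfield of the elements of `L` whose derivative lies in `L`. -/
def derivationComap (D : Derivation ℤ E E) (L : Subfield E) : Subfield E where
  carrier := {x | x ∈ L ∧ D x ∈ L}
  mul_mem' := fun {a b} ha hb => ⟨L.mul_mem ha.1 hb.1, by
    rw [Derivation.leibniz]
    exact L.add_mem (L.mul_mem ha.1 hb.2) (L.mul_mem hb.1 ha.2)⟩
  one_mem' := ⟨L.one_mem, by simp⟩
  add_mem' := fun {a b} ha hb => ⟨L.add_mem ha.1 hb.1, by
    rw [map_add]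
    exact L.add_mem ha.2 hb.2⟩
  zero_mem' := ⟨L.zero_mem, by simp⟩
  neg_mem' := fun {a} ha => ⟨L.neg_mem ha.1, by
    rw [map_neg]
    exact L.neg_mem ha.2⟩
  inv_mem' := fun a ha => ⟨L.inv_mem ha.1, by
    rw [Derivation.leibniz_inv]
    exact L.mul_mem (L.neg_mem (L.pow_mem (L.inv_mem ha.1) 2)) ha.2⟩

theorem derivation_mem_closure (D : Derivation ℤ E E) {S : Set E} {L : Subfield E}
    (hS : S ⊆ L) (hD : ∀ x ∈ S, D x ∈ L) {x : E} (hx : x ∈ Subfield.closure S) : D x ∈ L :=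
  (Subfield.closure_le (t := derivationComap D L).2 (fun y hy => ⟨hS hy, hD y hy⟩) hx).2

theorem derivation_aeval_sub_mem (D : Derivation ℤ E E) (L : Subfield E) {x : E} (hx : x ∈ L)
    (p : Polynomial (derivationComap D L)) :
    D (Polynomial.aeval x p) - Polynomial.aeval x (Polynomial.derivative p) * D x ∈ L := by
  induction p using Polynomial.induction_on' with
  | add p q hp hq =>
    convert L.add_mem hp hq using 1
    simp only [map_add]
    ring
  | monomial n a =>
    convert L.mul_mem (L.pow_mem hx n) a.2.2 using 1
    simp only [Polynomial.aeval_monomial, Derivation.leibniz, Derivation.leibniz_pow,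
      Polynomial.derivative_monomial, smul_eq_mul, nsmul_eq_mul, map_mul, map_natCast]
    change _ * (_ * (_ * _)) + _ * D (a : E) - (a : E) * _ * _ * _ = _
    change (a : E) * _ + _ - _ = _
    ring

theorem derivation_mem_of_isAlgebraic [CharZero E] (D : Derivation ℤ E E) (L : Subfield E) {x : E}
    (hx : x ∈ L) (h : IsAlgebraic (derivationComap D L) x) : D x ∈ L := by
  have hi : IsIntegral (derivationComap D L) x := h.isIntegral
  have hm := derivation_aeval_sub_mem D L hx (minpoly (derivationComap D L) x)
  have hp : Polynomial.aeval x (Polynomial.derivative (minpoly (derivationComap D L) x)) ≠ 0 :=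
    (minpoly.irreducible hi).separable.aeval_derivative_ne_zero (minpoly.aeval _ _)
  have hpL : Polynomial.aeval x (Polynomial.derivative (minpoly (derivationComap D L) x)) ∈ L := by
    rw [Polynomial.aeval_eq_sum_range]
    refine L.sum_mem fun i _ => ?_
    exact L.mul_mem
      (Polynomial.coeff (Polynomial.derivative (minpoly (derivationComap D L) x)) i).2.1
      (L.pow_mem hx i)
  rw [minpoly.aeval, map_zero, zero_sub] at hm
  have := L.mul_mem (L.inv_mem hpL) (L.neg_mem hm)
  rwa [neg_neg, inv_mul_cancel_left₀ hp] at this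

theorem derivation_mem_algClosureOf [CharZero E] (D : Derivation ℤ E E) {S T : Set E}
    (hS : S ⊆ algClosureOf T) (hD : ∀ x ∈ S, D x ∈ algClosureOf T) {x : E}
    (hx : x ∈ algClosureOf S) : D x ∈ algClosureOf T := by
  rw [← coe_algClosureSubfield] at hS hD ⊢
  refine derivation_mem_of_isAlgebraic D (algClosureSubfield T) ?_ (isAlgebraic_mono ?_ hx)
  · exact (coe_algClosureSubfield T).superset
      (algClosureOf_subset (hS.trans (coe_algClosureSubfield T).subset) hx)
  · exact Subfield.closure_le.2 fun y hy => ⟨hS hy, hD y hy⟩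

end DerivationClosure

section Specialization

open MvPolynomial

/-- If the constant coefficients of polynomials `p i` over `G` are algebraically independent over
`F`, then the `p i` together with the indeterminates are algebraically independent over `F`. -/
theorem algebraicIndependent_sumElim_X {F G σ ι : Type*} [Field F] [Field G] [Algebra F G]
    (p : ι → MvPolynomial σ G) (h : AlgebraicIndependent F fun i => constantCoeff (p i)) :
    AlgebraicIndependent F (Sum.elim X p : σ ⊕ ι → MvPolynomial σ G) := by
  classical
  let Φ : MvPolynomial σ (MvPolynomial ι F) →ₐ[F] MvPolynomial σ G := aevalTower (aeval p) X
  have hΦ : Function.Injective Φ := by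
    rw [injective_iff_map_eq_zero]
    intro Q hQ
    by_contra hne
    obtain ⟨α, hα⟩ := Q.support.exists_minimal (support_nonempty.2 hne)
    have hterm : ∀ β ∈ Q.support, coeff α (Φ (monomial β (coeff β Q))) =
        if β = α then constantCoeff (aeval p (coeff α Q)) else 0 := by
      intro β hβ
      have hmon : Φ (monomial β (coeff β Q)) = aeval p (coeff β Q) * monomial β 1 := by
        have h2 : Φ (monomial β (coeff β Q)) = aeval p (coeff β Q) * β.prod fun i e => X i ^ e :=
          eval₂_monomial _ _
        rw [h2, monomial_eq, C_1, one_mul]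
      rw [hmon, coeff_mul_monomial']
      by_cases e : β = α
      · subst e
        rw [if_pos rfl, if_pos le_rfl, tsub_self, mul_one, constantCoeff_eq]
      · rw [if_neg e, if_neg]
        exact fun hle => e (le_antisymm hle (hα.2 hβ hle))
    have h0 : coeff α (Φ Q) = constantCoeff (aeval p (coeff α Q)) := by
      conv_lhs => rw [Q.as_sum, map_sum, coeff_sum]
      rw [Finset.sum_congr rfl hterm, Finset.sum_ite_eq' , if_pos hα.1]
    rw [hQ, coeff_zero] at h0
    have h1 : aeval (fun i => constantCoeff (p i)) (coeff α Q) = constantCoeff (aeval p (coeff α Q)) := by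
      have : (aeval fun i => constantCoeff (p i)) =
          (aeval (R := G) (fun _ : σ => (0 : G)) |>.restrictScalars F).comp (aeval p) := by
        ext i
        simp
      rw [this]
      simp
    exact mem_support_iff.1 hα.1 (h.eq_zero_of_aeval_eq_zero _ (h1.trans h0.symm))
  have : aeval (Sum.elim X p : σ ⊕ ι → MvPolynomial σ G) =
      Φ.comp (sumAlgEquiv F σ ι).toAlgHom := by
    ext (i | i) <;> simp [Φ]
  rw [AlgebraicIndependent, this]
  exact hΦ.comp (sumAlgEquiv F σ ι).injective

theorem AlgebraicIndependent.add_algebraMap {R A ι : Type*} [CommRing R] [CommRing A] [Algebra R A]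
    {x : ι → A} (h : AlgebraicIndependent R x) (c : ι → R) :
    AlgebraicIndependent R fun i => x i + algebraMap R A (c i) := by
  let τ : MvPolynomial ι R →ₐ[R] MvPolynomial ι R := aeval fun i => X i + C (c i)
  let τ' : MvPolynomial ι R →ₐ[R] MvPolynomial ι R := aeval fun i => X i - C (c i)
  have hτ : τ'.comp τ = AlgHom.id R _ := by
    ext i
    simp [τ, τ', algHom_C]
  have h' : aeval (fun i => x i + algebraMap R A (c i)) = (aeval x).comp τ := by
    ext i
    simp [τ]
  rw [AlgebraicIndependent, h']
  have hi : Function.Injective τ :=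
    Function.LeftInverse.injective (g := τ') fun p => DFunLike.congr_fun hτ p
  rw [AlgHom.coe_comp]
  exact Function.Injective.comp h hi

/-- `y` is the value at `c` of a polynomial over `G` whose value at `U` is `x`. -/
def SpecializesTo {E σ : Type*} [Field E] (G : Subfield E) (U c : σ → E) (x y : E) : Prop :=
  ∃ p : MvPolynomial σ G, aeval U p = x ∧ aeval c p = y

theorem algebraicIndependent_sumElim_of_specializesTo {E σ ι : Type*} [Field E] {F G : Subfield E}
    (hFG : F ≤ G) {U : σ → E} (hU : AlgebraicIndependent G U) {c : σ → E} (hc : ∀ q, c q ∈ F)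
    {f g : ι → E} (hfg : ∀ i, SpecializesTo G U c (f i) (g i)) (hg : AlgebraicIndependent F g) :
    AlgebraicIndependent F (Sum.elim U f) := by
  let _ : Algebra F G := (Subfield.inclusion hFG).toAlgebra
  have _ : IsScalarTower F G E := IsScalarTower.of_algebraMap_eq fun _ => rfl
  choose p hpU hpc using hfg
  let c' : σ → F := fun q => ⟨c q, hc q⟩
  let c'' : σ → G := fun q => algebraMap F G (c' q)
  let τ : MvPolynomial σ G →ₐ[G] MvPolynomial σ G := aeval fun q => X q + C (c'' q)
  have hcc : ∀ P : MvPolynomial σ G, algebraMap G E (constantCoeff (τ P)) = aeval c P := by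
    intro P
    induction P using MvPolynomial.induction_on with
    | C a => simp [τ, algHom_C]
    | add a b ha hb => simp [ha, hb]
    | mul_X a q ha =>
      rw [map_mul, map_mul, map_mul, ha, map_mul]
      simp only [τ, aeval_X, map_add, constantCoeff_X, constantCoeff_C, zero_add]
      rfl
  have h1 : AlgebraicIndependent F fun i => constantCoeff (τ (p i)) := by
    have h2 : AlgebraicIndependent F ((IsScalarTower.toAlgHom F G E) ∘
        fun i => constantCoeff (τ (p i))) := by
      convert hg using 1
      funext i
      exact (hcc _).trans (hpc i)
    exact AlgebraicIndependent.of_comp _ h2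
  have h3 := algebraicIndependent_sumElim_X (fun i => τ (p i)) h1
  let ψ : MvPolynomial σ G →ₐ[G] E := aeval fun q => U q + algebraMap G E (-c'' q)
  have hψ : Function.Injective ψ := hU.add_algebraMap fun q => -c'' q
  have hψτ : ψ.comp τ = aeval U := by
    ext q
    simp [ψ, τ, algHom_C]
  have h4 := h3.map' (f := ψ.restrictScalars F) hψ
  have h5 := h4.add_algebraMap (Sum.elim c' 0)
  convert h5 using 1
  funext i
  rcases i with q | i
  · simp [ψ, c'', ← IsScalarTower.algebraMap_apply]
  · have := DFunLike.congr_fun hψτ (p i)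
    simp only [AlgHom.comp_apply, hpU] at this
    simp [this]

end Specialization

section SpecializesTo

variable {E σ : Type*} [Field E] {G : Subfield E} {U c : σ → E}

open MvPolynomial

theorem SpecializesTo.of_mem {a : E} (ha : a ∈ G) : SpecializesTo G U c a a :=
  ⟨C ⟨a, ha⟩, by rw [algHom_C]; rfl, by rw [algHom_C]; rfl⟩

theorem SpecializesTo.of_index (q : σ) : SpecializesTo G U c (U q) (c q) :=
  ⟨X q, aeval_X _ _, aeval_X _ _⟩

theorem SpecializesTo.add {x y x' y' : E} (h : SpecializesTo G U c x y)
    (h' : SpecializesTo G U c x' y') : SpecializesTo G U c (x + x') (y + y') := by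
  obtain ⟨p, rfl, rfl⟩ := h
  obtain ⟨q, rfl, rfl⟩ := h'
  exact ⟨p + q, map_add _ _ _, map_add _ _ _⟩

theorem SpecializesTo.mul {x y x' y' : E} (h : SpecializesTo G U c x y)
    (h' : SpecializesTo G U c x' y') : SpecializesTo G U c (x * x') (y * y') := by
  obtain ⟨p, rfl, rfl⟩ := h
  obtain ⟨q, rfl, rfl⟩ := h'
  exact ⟨p * q, map_mul _ _ _, map_mul _ _ _⟩

theorem SpecializesTo.neg {x y : E} (h : SpecializesTo G U c x y) :
    SpecializesTo G U c (-x) (-y) := by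
  obtain ⟨p, rfl, rfl⟩ := h
  exact ⟨-p, map_neg _ _, map_neg _ _⟩

theorem SpecializesTo.sum {ι : Type*} (s : Finset ι) {x y : ι → E}
    (h : ∀ i ∈ s, SpecializesTo G U c (x i) (y i)) :
    SpecializesTo G U c (∑ i ∈ s, x i) (∑ i ∈ s, y i) := by
  choose! p hx hy using h
  refine ⟨∑ i ∈ s, p i, ?_, ?_⟩
  · rw [map_sum]
    exact Finset.sum_congr rfl hx
  · rw [map_sum]
    exact Finset.sum_congr rfl hy

theorem SpecializesTo.derivation (D : Derivation ℤ E E) (hG : ∀ x ∈ G, D x ∈ G)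
    (hUc : ∀ q, SpecializesTo G U c (D (U q)) (D (c q))) {x y : E}
    (h : SpecializesTo G U c x y) : SpecializesTo G U c (D x) (D y) := by
  obtain ⟨p, rfl, rfl⟩ := h
  induction p using MvPolynomial.induction_on with
  | C a =>
    rw [algHom_C, algHom_C]
    exact .of_mem (hG a a.2)
  | add p q hp hq =>
    simp only [map_add]
    exact hp.add hq
  | mul_X p q hp =>
    simp only [map_mul, aeval_X, Derivation.leibniz, smul_eq_mul]
    exact (SpecializesTo.mul ⟨p, rfl, rfl⟩ (hUc q)).add ((SpecializesTo.of_index q).mul hp)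

theorem iterate_mem {D : E → E} {S : Subfield E} (hS : ∀ x ∈ S, D x ∈ S) {x : E} (hx : x ∈ S)
    (k : ℕ) : D^[k] x ∈ S := by
  induction k with
  | zero => exact hx
  | succ k ih =>
    rw [Function.iterate_succ_apply']
    exact hS _ ih

theorem SpecializesTo.iterate_derivation {Q : Type*} {u c : Q → E} (D : Derivation ℤ E E)
    (hG : ∀ x ∈ G, D x ∈ G) {x y : E}
    (h : SpecializesTo G (fun p : Q × ℕ => D^[p.2] (u p.1)) (fun p => D^[p.2] (c p.1)) x y)
    (k : ℕ) :
    SpecializesTo G (fun p : Q × ℕ => D^[p.2] (u p.1)) (fun p => D^[p.2] (c p.1))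
      (D^[k] x) (D^[k] y) := by
  induction k with
  | zero => exact h
  | succ k ih =>
    rw [Function.iterate_succ_apply', Function.iterate_succ_apply']
    refine ih.derivation D hG fun q => ?_
    rw [← Function.iterate_succ_apply' D, ← Function.iterate_succ_apply' D]
    exact SpecializesTo.of_index (σ := Q × ℕ) (U := fun p : Q × ℕ => D^[p.2] (u p.1))
      (c := fun p : Q × ℕ => D^[p.2] (c p.1)) (q.1, q.2 + 1)

end SpecializesTo

section GenericPolynomial

variable {E : Type*} [Field E]

/-- The exponent vector of the single derivative with index `p`. -/
def GenMon.single {n s m : ℕ} (hm : 1 ≤ m) (p : Fin n × Fin (s + 1)) : GenMon n s m :=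
  ⟨Pi.single p ⟨1, Nat.lt_succ_of_le hm⟩, by
    have h : ∀ q, ((Pi.single p (⟨1, Nat.lt_succ_of_le hm⟩ : Fin (m + 1)) :
        Fin n × Fin (s + 1) → Fin (m + 1)) q : ℕ) = if q = p then 1 else 0 := by
      intro q
      rw [Pi.single_apply]
      split_ifs <;> rfl
    simp only [h, Finset.sum_ite_eq', Finset.mem_univ, if_true]
    exact ⟨le_rfl, hm⟩⟩

theorem monValue_single (D : E → E) {n s m : ℕ} (hm : 1 ≤ m) (ξ : Fin n → E)
    (p : Fin n × Fin (s + 1)) :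
    monValue D s m ξ (GenMon.single hm p) = D^[(p.2 : ℕ)] (ξ p.1) := by
  rw [monValue, Finset.prod_eq_single p]
  · simp [GenMon.single]
  · intro q _ hq
    simp [GenMon.single, Pi.single_eq_of_ne hq]
  · simp

theorem monValue_mem {D : E → E} {n s m : ℕ} {ξ : Fin n → E} (L : Subfield E)
    (h : ∀ i, ∀ k ≤ s, D^[k] (ξ i) ∈ L) (α : GenMon n s m) : monValue D s m ξ α ∈ L :=
  L.prod_mem fun p _ => L.pow_mem (h _ _ (Nat.le_of_lt_succ p.2.2)) _

end GenericPolynomial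

section TranscendenceDegree

variable {E : Type*} [Field E]

open AlgebraicIndependent

theorem matroid_eRk_eq_toENat_trdeg (k : Subfield E) (S : Set E) :
    (matroid k E).eRk S = Cardinal.toENat (Trdeg k (IntermediateField.adjoin k S)) := by
  obtain ⟨B, hB⟩ := (matroid k E).exists_isBasis S
  have hBS : B ⊆ IntermediateField.adjoin k S :=
    hB.subset.trans (IntermediateField.subset_adjoin k S)
  let x : B → IntermediateField.adjoin k S := fun b => ⟨b, hBS b.2⟩
  have hBi : AlgebraicIndependent k ((↑) : B → E) := matroid_indep_iff.1 hB.indep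
  have hx : AlgebraicIndependent k x :=
    AlgebraicIndependent.of_comp (IntermediateField.adjoin k S).val hBi
  have hb : IsTranscendenceBasis k x := by
    refine hx.isTranscendenceBasis_iff.2 fun κ w hw j hj c => ?_
    by_contra hc
    have hw' := (algebraicIndependent_iff_notMem_algClosureOf k _).1
      (hw.map' (f := (IntermediateField.adjoin k S).val) Subtype.val_injective) c
    have hS : (w c : E) ∈ algClosureOf (↑k ∪ B) := by
      rw [← matroid_closure_eq_algClosureOf, hB.closure_eq_closure,
        matroid_closure_eq_algClosureOf]
      refine closure_subset_algClosureOf _ ?_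
      rw [← adjoin_toSubfield_eq_closure]
      exact (w c).2
    refine hw' (algClosureOf_mono (Set.union_subset_union_right _ ?_) hS)
    exact fun b hb => ⟨j ⟨b, hb⟩, fun e => hc ⟨_, e⟩, congrArg Subtype.val (congrFun hj ⟨b, hb⟩)⟩
  rw [← hB.encard_eq_eRk, ← Set.toENat_cardinalMk, hb.cardinalMk_eq_trdeg]
  rfl

theorem trdeg_adjoin_eq_natCast_iff (k : Subfield E) (S : Set E) (N : ℕ) :
    Trdeg k (IntermediateField.adjoin k S) = N ↔ (matroid k E).eRk S = N := by
  rw [matroid_eRk_eq_toENat_trdeg, Cardinal.toENat_eq_natCast]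

theorem AlgebraicIndependent.of_sumElim_of_subset {σ ι : Type*} {F k : Subfield E} {U : σ → E}
    {f : ι → E} (h : AlgebraicIndependent F (Sum.elim U f))
    (hk : (k : Set E) ⊆ algClosureOf (↑F ∪ Set.range U)) : AlgebraicIndependent k f := by
  rw [algebraicIndependent_iff_notMem_algClosureOf] at h ⊢
  intro i hi
  refine h (Sum.inr i) (algClosureOf_subset (Set.union_subset ?_ ?_) hi)
  · refine hk.trans (algClosureOf_mono (Set.union_subset_union_right _ ?_))
    rintro _ ⟨q, rfl⟩
    exact ⟨Sum.inl q, by simp, rfl⟩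
  · refine Set.Subset.trans ?_ (subset_algClosureOf _)
    rintro _ ⟨j, hj, rfl⟩
    exact Or.inr ⟨Sum.inr j, by simpa using hj, rfl⟩

end TranscendenceDegree

section Prolongation

/-- The set of derivatives of order at most `t` of the entries of `ξ`. -/
def derivSet {E : Type*} {n : ℕ} (δ : E → E) (ξ : Fin n → E) (t : ℕ) : Set E :=
  {x : E | ∃ i : Fin n, ∃ j ≤ t, δ^[j] (ξ i) = x}

theorem derivSet_mono {E : Type*} {n : ℕ} (δ : E → E) (ξ : Fin n → E) {s t : ℕ} (h : s ≤ t) :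
    derivSet δ ξ s ⊆ derivSet δ ξ t := by
  rintro _ ⟨i, j, hj, rfl⟩
  exact ⟨i, j, hj.trans h, rfl⟩

variable {E : Type*} [Field E]

open AlgebraicIndependent

theorem HasDimOrder.exists_eRk {n d h : ℕ} {δ : E → E} {F : Subfield E} {ξ : Fin n → E}
    (hdim : HasDimOrder δ F ξ d h) :
    ∃ T : ℕ, ∀ t ≥ T, (matroid F E).eRk (derivSet δ ξ t) = ((d * (t + 1) + h : ℕ) : ℕ∞) := by
  obtain ⟨T, hT⟩ := hdim
  exact ⟨T, fun t ht => (trdeg_adjoin_eq_natCast_iff _ _ _).1 (hT t ht)⟩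

theorem exists_top_derivatives {J : Type*} [Fintype J] {n h t : ℕ} {δ : E → E} {F : Subfield E}
    {ξ : Fin n → E}
    (h₀ : (matroid F E).eRk (derivSet δ ξ t) = ((Fintype.card J * (t + 1) + h : ℕ) : ℕ∞))
    (h₁ : (matroid F E).eRk (derivSet δ ξ (t + 1)) =
      ((Fintype.card J * (t + 1 + 1) + h : ℕ) : ℕ∞)) :
    ∃ l : J → Fin n, derivSet δ ξ (t + 1) ⊆
      algClosureOf (↑F ∪ (derivSet δ ξ t ∪ Set.range fun a => δ^[t + 1] (ξ (l a)))) := by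
  obtain ⟨I, hI⟩ := (matroid F E).exists_isBasis (derivSet δ ξ t)
  obtain ⟨B, hB, hIB⟩ := hI.exists_isBasis_inter_eq_of_superset
    (derivSet_mono δ ξ (Nat.le_succ t))
  have hcI : I.encard = ((Fintype.card J * (t + 1) + h : ℕ) : ℕ∞) := hI.encard_eq_eRk.trans h₀
  have hcB : B.encard = ((Fintype.card J * (t + 1 + 1) + h : ℕ) : ℕ∞) := hB.encard_eq_eRk.trans h₁
  have hsub : I ⊆ B := hIB ▸ Set.inter_subset_left
  have hd : (B \ I).encard = (Fintype.card J : ℕ∞) := by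
    have hadd := Set.encard_sdiff_add_encard_of_subset hsub
    rw [hcI, hcB, show Fintype.card J * (t + 1 + 1) + h =
      Fintype.card J + (Fintype.card J * (t + 1) + h) by ring, Nat.cast_add (Fintype.card J)] at hadd
    exact WithTop.add_right_cancel (ENat.natCast_ne_top _) hadd
  have hfin : (B \ I).Finite := Set.finite_of_encard_eq_coe hd
  have _ : Finite ↑(B \ I) := hfin
  have hcard : Nat.card J = Nat.card ↑(B \ I) := by
    rw [Nat.card_eq_fintype_card, Nat.card_coe_set_eq, Set.ncard, hd, ENat.toNat_natCast]
  obtain ⟨e⟩ := Finite.card_eq.1 hcard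
  have hl : ∀ a, ∃ i, δ^[t + 1] (ξ i) = e a := by
    intro a
    obtain ⟨i, j, hj, hij⟩ := hB.subset (e a).2.1
    rcases Nat.lt_or_ge t j with hlt | hge
    · exact ⟨i, by rw [← hij, show j = t + 1 by lia]⟩
    · exact absurd (hIB.subset ⟨(e a).2.1, i, j, hge, hij⟩) (e a).2.2
  choose l hl using hl
  refine ⟨l, ?_⟩
  have hcl := hB.subset_closure
  rw [matroid_closure_eq_algClosureOf] at hcl
  refine hcl.trans (algClosureOf_mono (Set.union_subset_union_right _ fun b hb => ?_))
  by_cases hbI : b ∈ I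
  · exact Or.inl (hI.subset hbI)
  · exact Or.inr ⟨e.symm ⟨b, hb, hbI⟩, by simp [hl]⟩

theorem derivSet_succ_subset_algClosureOf [CharZero E] {J : Type*} {n : ℕ} (D : Derivation ℤ E E)
    {F : Subfield E} (hF : ∀ x ∈ F, D x ∈ F) {ξ : Fin n → E} {l : J → Fin n} {T : ℕ}
    (hT : derivSet D ξ (T + 1) ⊆
      algClosureOf (↑F ∪ (derivSet D ξ T ∪ Set.range fun a => D^[T + 1] (ξ (l a)))))
    {t : ℕ} (ht : T ≤ t) : derivSet D ξ (t + 1) ⊆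
      algClosureOf (↑F ∪ (derivSet D ξ t ∪ Set.range fun a => D^[t + 1] (ξ (l a)))) := by
  induction t, ht using Nat.le_induction with
  | base => exact hT
  | succ t ht ih =>
    have hsub := subset_algClosureOf (↑F ∪ (derivSet D ξ (t + 1) ∪
      Set.range fun a => D^[t + 1 + 1] (ξ (l a))))
    rintro _ ⟨i, j, hj, rfl⟩
    rcases Nat.lt_or_ge (t + 1) j with hlt | hge
    · obtain rfl : j = t + 1 + 1 := by lia
      rw [Function.iterate_succ_apply']
      refine derivation_mem_algClosureOf D ?_ ?_ (ih ⟨i, t + 1, le_rfl, rfl⟩)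
      · refine Set.Subset.trans ?_ hsub
        refine Set.union_subset_union_right _ (Set.union_subset ?_ ?_)
        · exact (derivSet_mono _ _ (Nat.le_succ t)).trans Set.subset_union_left
        · rintro _ ⟨a, rfl⟩
          exact Or.inl ⟨l a, t + 1, le_rfl, rfl⟩
      · rintro x (hx | ⟨i, j, hj, rfl⟩ | ⟨a, rfl⟩) <;> apply hsub
        · exact Or.inl (hF x hx)
        · exact Or.inr (Or.inl ⟨i, j + 1, by lia, Function.iterate_succ_apply' _ _ _⟩)
        · exact Or.inr (Or.inr ⟨a, Function.iterate_succ_apply' _ _ _⟩)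
    · exact hsub (Or.inr (Or.inl ⟨i, j, hge, rfl⟩))

theorem top_derivative_notMem_algClosureOf {J : Type*} [Fintype J] {n h t : ℕ} {δ : E → E}
    {F : Subfield E} {ξ : Fin n → E} {l : J → Fin n}
    (h₀ : (matroid F E).eRk (derivSet δ ξ t) = ((Fintype.card J * (t + 1) + h : ℕ) : ℕ∞))
    (h₁ : (matroid F E).eRk (derivSet δ ξ (t + 1)) =
      ((Fintype.card J * (t + 1 + 1) + h : ℕ) : ℕ∞))
    (hl : derivSet δ ξ (t + 1) ⊆
      algClosureOf (↑F ∪ (derivSet δ ξ t ∪ Set.range fun a => δ^[t + 1] (ξ (l a))))) (a : J) :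
    δ^[t + 1] (ξ (l a)) ∉
      algClosureOf (↑F ∪ (derivSet δ ξ t ∪ (fun a => δ^[t + 1] (ξ (l a))) '' {a}ᶜ)) := by
  classical
  intro ha
  have hsub : derivSet δ ξ (t + 1) ⊆
      algClosureOf (↑F ∪ (derivSet δ ξ t ∪ (fun a => δ^[t + 1] (ξ (l a))) '' {a}ᶜ)) := by
    refine hl.trans (algClosureOf_subset (Set.union_subset ?_ (Set.union_subset ?_ ?_)))
    · exact Set.subset_union_left.trans (subset_algClosureOf _)
    · exact (Set.subset_union_left.trans Set.subset_union_right).trans (subset_algClosureOf _)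
    · rintro _ ⟨b, rfl⟩
      rcases eq_or_ne b a with rfl | hb
      · exact ha
      · exact subset_algClosureOf _ (Or.inr (Or.inr ⟨b, hb, rfl⟩))
  rw [← matroid_closure_eq_algClosureOf] at hsub
  have hle := (matroid F E).eRk_mono hsub
  rw [Matroid.eRk_closure_eq, h₁] at hle
  have hle' := hle.trans (((matroid F E).eRk_union_le_eRk_add_encard _ _).trans
    (add_le_add_right (Set.encard_image_le _ _) _))
  have hc : ({a}ᶜ : Set J).encard = ((Fintype.card J - 1 : ℕ) : ℕ∞) := by
    rw [Set.encard_eq_coe_toFinset_card]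
    simp [Finset.card_compl]
  rw [h₀, hc, ← Nat.cast_add, Nat.cast_le] at hle'
  have hpos : 0 < Fintype.card J := Fintype.card_pos_iff.2 ⟨a⟩
  have : Fintype.card J * (t + 1 + 1) = Fintype.card J * (t + 1) + Fintype.card J := by ring
  lia

theorem algebraicIndependent_derivatives [CharZero E] {J : Type*} {n T : ℕ}
    (D : Derivation ℤ E E) {F : Subfield E} (hF : ∀ x ∈ F, D x ∈ F) {ξ : Fin n → E}
    {l : J → Fin n}
    (hT : ∀ t ≥ T, ∀ a, D^[t + 1] (ξ (l a)) ∉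
      algClosureOf (↑F ∪ (derivSet D ξ t ∪ (fun a => D^[t + 1] (ξ (l a))) '' {a}ᶜ))) :
    AlgebraicIndependent F fun p : J × ℕ => D^[p.2] (ξ (l p.1)) := by
  refine algebraicIndependent_of_rank F _ Prod.snd fun ⟨a, k⟩ hk => ?_
  have key : ∀ m, D^[k + m] (ξ (l a)) ∈ algClosureOf (↑F ∪
      (fun p : J × ℕ => D^[p.2] (ξ (l p.1))) '' {j | j ≠ (a, k + m) ∧ j.2 ≤ k + m}) := by
    intro m
    induction m with
    | zero => exact hk
    | succ m ih =>
      rw [← Nat.add_assoc, Function.iterate_succ_apply']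
      refine derivation_mem_algClosureOf D ?_ ?_ ih
      · refine Set.Subset.trans ?_ (subset_algClosureOf _)
        refine Set.union_subset_union_right _ (Set.image_mono fun j hj => ⟨?_, ?_⟩)
        · rintro rfl
          have := hj.2
          simp at this
        · exact hj.2.trans (Nat.le_succ _)
      · rintro x (hx | ⟨⟨a', k'⟩, ⟨hne, hk'⟩, rfl⟩) <;> apply subset_algClosureOf
        · exact Or.inl (hF x hx)
        · refine Or.inr ⟨(a', k' + 1), ⟨fun e => hne ?_, Nat.succ_le_succ hk'⟩,
            Function.iterate_succ_apply' _ _ _⟩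
          simpa using e
  refine hT (k + T) (Nat.le_add_left _ _) a (algClosureOf_mono ?_ (key (T + 1)))
  refine Set.union_subset_union_right _ ?_
  rintro _ ⟨⟨a', k'⟩, ⟨hne, hk'⟩, rfl⟩
  rcases Nat.lt_or_ge (k + T) k' with hlt | hge
  · obtain rfl : k' = k + T + 1 := le_antisymm hk' hlt
    exact Or.inr ⟨a', fun e => hne (by rw [Set.mem_singleton_iff.1 e]; rfl), rfl⟩
  · exact Or.inl ⟨l a', k', hge, rfl⟩

theorem algebraicIndependent_basis_sumElim_derivatives {J : Type*} {n T : ℕ}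
    {δ : E → E} {F : Subfield E} {ξ : Fin n → E} {l : J → Fin n}
    (hT : ∀ t ≥ T, ∀ a, δ^[t + 1] (ξ (l a)) ∉
      algClosureOf (↑F ∪ (derivSet δ ξ t ∪ (fun a => δ^[t + 1] (ξ (l a))) '' {a}ᶜ)))
    {t : ℕ} (ht : T ≤ t) {I : Set E} (hI : (matroid F E).IsBasis I (derivSet δ ξ t)) :
    AlgebraicIndependent F
      (Sum.elim ((↑) : I → E) fun p : J × ℕ => δ^[t + 1 + p.2] (ξ (l p.1))) := by
  refine algebraicIndependent_of_rank F _ (Sum.elim (fun _ => 0) fun p => p.2 + 1) ?_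
  rintro (b | ⟨a, k⟩) hx
  · have hIi : AlgebraicIndependent F ((↑) : I → E) := matroid_indep_iff.1 hI.indep
    refine (algebraicIndependent_iff_notMem_algClosureOf _ _).1 hIi b (algClosureOf_mono ?_ hx)
    refine Set.union_subset_union_right _ ?_
    rintro _ ⟨b' | ⟨a', k'⟩, ⟨hne, hle⟩, rfl⟩
    · exact ⟨b', fun e => hne (congrArg _ e), rfl⟩
    · simp at hle
  · have hnot := hT (t + k) (ht.trans (Nat.le_add_right _ _)) a
    rw [Nat.add_right_comm t k 1] at hnot
    refine hnot (algClosureOf_mono ?_ hx)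
    refine Set.union_subset_union_right _ ?_
    rintro _ ⟨b' | ⟨a', k'⟩, ⟨hne, hle⟩, rfl⟩
    · exact Or.inl (derivSet_mono _ _ (Nat.le_add_right t k) (hI.subset b'.2))
    · simp only [Sum.elim_inr] at hle ⊢
      rcases Nat.lt_or_ge k' k with hlt | hge
      · exact Or.inl ⟨l a', t + 1 + k', by lia, rfl⟩
      · obtain rfl : k' = k := by lia
        exact Or.inr ⟨a', fun e => hne (by rw [Set.mem_singleton_iff.1 e]), rfl⟩

theorem HasDimOrder.exists_indices [CharZero E] {J : Type*} [Fintype J] {n h : ℕ}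
    (D : Derivation ℤ E E) {F : Subfield E} (hF : ∀ x ∈ F, D x ∈ F) {ξ : Fin n → E}
    (hdim : HasDimOrder D F ξ (Fintype.card J) h) :
    ∃ (l : J → Fin n) (T : ℕ),
      (∀ t ≥ T, (matroid F E).eRk (derivSet D ξ t) =
        ((Fintype.card J * (t + 1) + h : ℕ) : ℕ∞)) ∧
      AlgebraicIndependent F (fun p : J × ℕ => D^[p.2] (ξ (l p.1))) ∧
      ∀ t ≥ T, ∀ I, (matroid F E).IsBasis I (derivSet D ξ t) → AlgebraicIndependent F
        (Sum.elim ((↑) : I → E) fun p : J × ℕ => D^[t + 1 + p.2] (ξ (l p.1))) := by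
  obtain ⟨T, hT⟩ := hdim.exists_eRk
  obtain ⟨l, hl⟩ := exists_top_derivatives (hT T le_rfl) (hT (T + 1) (Nat.le_succ T))
  have hnot : ∀ t ≥ T, ∀ a, D^[t + 1] (ξ (l a)) ∉
      algClosureOf (↑F ∪ (derivSet D ξ t ∪ (fun a => D^[t + 1] (ξ (l a))) '' {a}ᶜ)) :=
    fun t ht => top_derivative_notMem_algClosureOf (hT t ht) (hT (t + 1) (ht.trans (Nat.le_succ t)))
      (derivSet_succ_subset_algClosureOf D hF hl ht)
  exact ⟨l, T, hT, algebraicIndependent_derivatives D hF hnot,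
    fun t ht I hI => algebraicIndependent_basis_sumElim_derivatives hnot ht hI⟩

end Prolongation

section RankCount

open AlgebraicIndependent

theorem encard_add_le {J : Type*} [Fintype J] (s : J → ℕ) (t : ℕ) :
    {p : J × ℕ | p.2 + s p.1 ≤ t}.encard = ((∑ j, (t + 1 - s j) : ℕ) : ℕ∞) := by
  classical
  have h : {p : J × ℕ | p.2 + s p.1 ≤ t} =
      ((Finset.univ ×ˢ Finset.range (t + 1)).filter fun p : J × ℕ => p.2 + s p.1 ≤ t :
        Finset (J × ℕ)) := by
    ext ⟨j, k⟩
    simp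
    lia
  rw [h, Set.encard_coe_eq_coe_finsetCard, Finset.card_filter, Finset.sum_product]
  congr 1
  refine Finset.sum_congr rfl fun j _ => ?_
  rw [← Finset.card_filter]
  have : (Finset.range (t + 1)).filter (fun k => k + s j ≤ t) = Finset.range (t + 1 - s j) := by
    ext k
    simp
    lia
  rw [this, Finset.card_range]

theorem sum_sub_add_sum {J : Type*} [Fintype J] {s : J → ℕ} {t : ℕ} (hs : ∀ j, s j ≤ t) :
    ∑ j, (t + 1 - s j) + ∑ j, s j = Fintype.card J * (t + 1) := by
  rw [← Finset.sum_add_distrib, Finset.sum_congr rfl fun j _ =>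
    Nat.sub_add_cancel ((hs j).trans (Nat.le_succ t))]
  simp

variable {E : Type*} [Field E]

theorem matroid_indep_image {ι : Type*} {k : Subfield E} {x : ι → E}
    (hx : AlgebraicIndependent k x) (s : Set ι) : (matroid k E).Indep (x '' s) := by
  rw [matroid_indep_iff]
  have h := (hx.comp _ (Subtype.val_injective (p := (· ∈ s)))).coe_range
  rwa [Set.range_comp, Subtype.range_coe] at h

theorem matroid_eRk_le_of_le {F K : Subfield E} (hFK : F ≤ K) (S : Set E) :
    (matroid K E).eRk S ≤ (matroid F E).eRk S := by
  obtain ⟨I, hI⟩ := (matroid F E).exists_isBasis S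
  have hS : S ⊆ (matroid K E).closure I := by
    refine hI.subset_closure.trans ?_
    rw [matroid_closure_eq_algClosureOf, matroid_closure_eq_algClosureOf]
    exact algClosureOf_mono (Set.union_subset_union_left _ hFK)
  calc (matroid K E).eRk S ≤ (matroid K E).eRk ((matroid K E).closure I) :=
        (matroid K E).eRk_mono hS
    _ = (matroid K E).eRk I := Matroid.eRk_closure_eq _ _
    _ ≤ I.encard := (matroid K E).eRk_le_encard I
    _ = _ := hI.encard_eq_eRk

variable {J : Type*} [Fintype J] {n h t : ℕ} {δ : E → E} {F K L : Subfield E} {ξ : Fin n → E}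
  {s : J → ℕ} {ζ : J → E}

/-- The derivatives of order at most `t` of `ξ` contain a set of the expected size which, over `K`,
is independent from all derivatives of `ζ`. -/
theorem exists_complement_derivatives (hFK : F ≤ K) (hs : ∀ j, s j ≤ t)
    (hrank : (matroid F E).eRk (derivSet δ ξ t) = ((Fintype.card J * (t + 1) + h : ℕ) : ℕ∞))
    (hmem : ∀ j k, δ^[k] (ζ j) ∈ algClosureOf (↑K ∪ derivSet δ ξ (k + s j)))
    (hζ : AlgebraicIndependent K fun p : J × ℕ => δ^[p.2] (ζ p.1))
    {I : Set E} (hI : (matroid F E).IsBasis I (derivSet δ ξ t))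
    (hIζ : AlgebraicIndependent K
      (Sum.elim ((↑) : I → E) fun p : J × ℕ => δ^[t + 1 - s p.1 + p.2] (ζ p.1))) :
    ∃ b ⊆ derivSet δ ξ t, b.encard = ((h + ∑ j, s j : ℕ) : ℕ∞) ∧ AlgebraicIndependent K
      (Sum.elim (fun p : J × ℕ => δ^[p.2] (ζ p.1)) ((↑) : b → E)) := by
  let low : Set (J × ℕ) := {p | p.2 + s p.1 ≤ t}
  let Z := (fun p : J × ℕ => δ^[p.2] (ζ p.1)) '' low
  have hZ : (matroid K E).Indep Z := matroid_indep_image hζ low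
  obtain ⟨B, hB, hZB⟩ := hZ.subset_isBasis_of_subset (Set.subset_union_right (s := I) (t := Z))
  have hdI : derivSet δ ξ t ⊆ algClosureOf (↑K ∪ I) := by
    have := hI.subset_closure
    rw [matroid_closure_eq_algClosureOf] at this
    exact this.trans (algClosureOf_mono (Set.union_subset_union_left _ hFK))
  have hX : I ∪ Z ⊆ algClosureOf (↑K ∪ I) := by
    refine Set.union_subset (Set.subset_union_right.trans (subset_algClosureOf _)) ?_
    rintro _ ⟨⟨j, k⟩, hjk, rfl⟩
    refine algClosureOf_subset (Set.union_subset ?_ ?_) (hmem j k)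
    · exact Set.subset_union_left.trans (subset_algClosureOf _)
    · exact (derivSet_mono _ _ hjk).trans hdI
  have hII : (matroid K E).Indep I := by
    have := matroid_indep_image hIζ (Set.range Sum.inl)
    rwa [← Set.range_comp, Sum.elim_comp_inl, Subtype.range_coe] at this
  have hBc : B.encard = ((Fintype.card J * (t + 1) + h : ℕ) : ℕ∞) := by
    rw [← hrank, ← hI.encard_eq_eRk, hB.encard_eq_eRk]
    refine le_antisymm ?_ ?_
    · rw [← hII.eRk_eq_encard, ← Matroid.eRk_closure_eq _ I, matroid_closure_eq_algClosureOf]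
      exact (matroid K E).eRk_mono hX
    · rw [← hII.eRk_eq_encard]
      exact (matroid K E).eRk_mono Set.subset_union_left
  have hZc : Z.encard = ((∑ j, (t + 1 - s j) : ℕ) : ℕ∞) := by
    rw [hζ.injective.encard_image, encard_add_le]
  have hBZ : B \ Z ⊆ derivSet δ ξ t := fun x hx =>
    ((hB.subset hx.1).resolve_right hx.2 |> fun h => hI.subset h)
  refine ⟨B \ Z, hBZ, ?_, ?_⟩
  · have hadd := Set.encard_sdiff_add_encard_of_subset hZB
    rw [hBc, hZc, ← sum_sub_add_sum hs, show ∑ j, (t + 1 - s j) + ∑ j, s j + h =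
      (h + ∑ j, s j) + ∑ j, (t + 1 - s j) by ring, Nat.cast_add (h + ∑ j, s j)] at hadd
    exact WithTop.add_right_cancel (ENat.natCast_ne_top _) hadd
  · have hBi : AlgebraicIndependent K ((↑) : B → E) := matroid_indep_iff.1 hB.indep
    rw [algebraicIndependent_iff_notMem_algClosureOf] at hIζ hBi
    refine algebraicIndependent_of_rank K _
      (Sum.elim (fun p => p.2 + s p.1 - t) fun _ => 0) ?_
    rintro (⟨j, k⟩ | b) hx
    · rcases Nat.lt_or_ge t (k + s j) with hlt | hge
      · have hk : t + 1 - s j + (k + s j - (t + 1)) = k := by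
          have := hs j
          lia
        refine hIζ (Sum.inr (j, k + s j - (t + 1))) ?_
        simp only [Sum.elim_inr, hk]
        refine algClosureOf_subset (Set.union_subset ?_ ?_) hx
        · exact Set.subset_union_left.trans (subset_algClosureOf _)
        · have hIsub : algClosureOf (↑K ∪ I) ⊆ algClosureOf (↑K ∪
              (Sum.elim ((↑) : I → E) fun p : J × ℕ => δ^[t + 1 - s p.1 + p.2] (ζ p.1)) ''
                {Sum.inr (j, k + s j - (t + 1))}ᶜ) := by
            refine algClosureOf_mono (Set.union_subset_union_right _ fun b hb => ?_)
            exact ⟨Sum.inl ⟨b, hb⟩, by simp, rfl⟩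
          rintro _ ⟨⟨j', k'⟩ | b, ⟨hne, hle⟩, rfl⟩
          · rcases Nat.lt_or_ge t (k' + s j') with hlt' | hge'
            · have hk' : t + 1 - s j' + (k' + s j' - (t + 1)) = k' := by
                have := hs j'
                lia
              refine subset_algClosureOf _ (Or.inr ⟨Sum.inr (j', k' + s j' - (t + 1)), ?_, ?_⟩)
              · intro e
                simp only [Set.mem_singleton_iff, Sum.inr.injEq, Prod.mk.injEq] at e
                obtain ⟨rfl, e⟩ := e
                refine hne ?_
                rw [show k' = k by lia]
              · simp only [Sum.elim_inr, Sum.elim_inl, hk']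
            · exact hIsub (hX (Or.inr ⟨(j', k'), hge', rfl⟩))
          · exact hIsub (hX (hB.subset b.2.1))
      · refine hBi ⟨δ^[k] (ζ j), hZB ⟨(j, k), hge, rfl⟩⟩ (algClosureOf_mono ?_ hx)
        refine Set.union_subset_union_right _ ?_
        rintro _ ⟨⟨j', k'⟩ | b, ⟨hne, hle⟩, rfl⟩
        · simp only [Sum.elim_inl] at hle
          refine ⟨⟨δ^[k'] (ζ j'), hZB ⟨(j', k'), ?_, rfl⟩⟩, fun e => hne ?_, rfl⟩
          · change k' + s j' ≤ t
            lia
          · exact congrArg Sum.inl (hζ.injective (congrArg Subtype.val e))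
        · refine ⟨⟨b, b.2.1⟩, fun e => b.2.2 ?_, rfl⟩
          exact ⟨(j, k), hge, (congrArg Subtype.val e).symm⟩
    · refine hBi ⟨b, b.2.1⟩ (algClosureOf_mono ?_ hx)
      refine Set.union_subset_union_right _ ?_
      rintro _ ⟨⟨j', k'⟩ | b', ⟨hne, hle⟩, rfl⟩
      · simp only [Sum.elim_inl, Sum.elim_inr] at hle
        have hmemZ : δ^[k'] (ζ j') ∈ Z := ⟨(j', k'), show k' + s j' ≤ t by lia, rfl⟩
        refine ⟨⟨_, hZB hmemZ⟩, fun e => b.2.2 ?_, rfl⟩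
        rwa [← congrArg Subtype.val e]
      · refine ⟨⟨b', b'.2.1⟩, fun e => hne ?_, rfl⟩
        have e' : (b' : E) = b := congrArg (fun c : B => (c : E)) (Set.mem_singleton_iff.1 e)
        exact congrArg Sum.inr (Subtype.ext e')

theorem derivSet_subset_of_complement {T : ℕ} {b : Set E}
    (hFK : F ≤ K) (hKL : K ≤ L) (hL : ∀ j k, δ^[k] (ζ j) ∈ L) (hs : ∀ j, s j ≤ T)
    (hrank : ∀ t ≥ T, (matroid F E).eRk (derivSet δ ξ t) =
      ((Fintype.card J * (t + 1) + h : ℕ) : ℕ∞))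
    (hmem : ∀ j k, δ^[k] (ζ j) ∈ algClosureOf (↑K ∪ derivSet δ ξ (k + s j)))
    (hb : b ⊆ derivSet δ ξ T) (hbc : b.encard = ((h + ∑ j, s j : ℕ) : ℕ∞))
    (hζb : AlgebraicIndependent K
      (Sum.elim (fun p : J × ℕ => δ^[p.2] (ζ p.1)) ((↑) : b → E))) (t : ℕ) :
    derivSet δ ξ t ⊆ algClosureOf (↑L ∪ b) := by
  intro x hx
  by_contra hxb
  have hx' := derivSet_mono δ ξ (Nat.le_max_left t T) hx
  have hT : T ≤ max t T := Nat.le_max_right t T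
  generalize max t T = t' at hx' hT
  let low : Set (J × ℕ) := {p | p.2 + s p.1 ≤ t'}
  let Z := (fun p : J × ℕ => δ^[p.2] (ζ p.1)) '' low
  have himage : (Sum.elim (fun p : J × ℕ => δ^[p.2] (ζ p.1)) ((↑) : b → E)) ''
      (Sum.inl '' low ∪ Set.range Sum.inr) = Z ∪ b := by
    rw [Set.image_union, Set.image_image, ← Set.range_comp, Sum.elim_comp_inr, Subtype.range_coe]
    rfl
  have hZb : (matroid K E).Indep (Z ∪ b) := himage ▸ matroid_indep_image hζb _
  have hZbc : (Z ∪ b).encard = ((Fintype.card J * (t' + 1) + h : ℕ) : ℕ∞) := by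
    rw [← himage, hζb.injective.encard_image, Set.encard_union_eq, Sum.inl_injective.encard_image,
      encard_add_le, ← Set.image_univ, Sum.inr_injective.encard_image, Set.encard_univ, ENat.card_coe_set_eq, hbc,
      ← Nat.cast_add, ← sum_sub_add_sum fun j => (hs j).trans hT]
    · congr 1
      ring
    · rw [Set.disjoint_left]
      rintro _ ⟨p, _, rfl⟩ ⟨c, hc⟩
      simp at hc
  have hxZ : x ∉ (matroid K E).closure (Z ∪ b) := by
    rw [matroid_closure_eq_algClosureOf]
    refine fun hxZ => hxb (algClosureOf_mono ?_ hxZ)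
    refine Set.union_subset (Set.subset_union_of_subset_left hKL _) (Set.union_subset ?_ ?_)
    · rintro _ ⟨p, _, rfl⟩
      exact Or.inl (hL _ _)
    · exact Set.subset_union_right
  have hins : (matroid K E).Indep (insert x (Z ∪ b)) :=
    (hZb.insert_indep_iff).2 (Or.inl ⟨Set.mem_univ x, hxZ⟩)
  have hsub : insert x (Z ∪ b) ⊆ (matroid K E).closure (derivSet δ ξ t') := by
    rw [matroid_closure_eq_algClosureOf]
    refine Set.insert_subset (subset_algClosureOf _ (Or.inr hx')) (Set.union_subset ?_ ?_)
    · rintro _ ⟨⟨j, k⟩, hjk, rfl⟩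
      exact algClosureOf_mono (Set.union_subset_union_right _ (derivSet_mono _ _ hjk)) (hmem j k)
    · exact (hb.trans (derivSet_mono _ _ hT)).trans
        (Set.subset_union_right.trans (subset_algClosureOf _))
  have hle := hins.encard_le_eRk_of_subset hsub
  rw [Matroid.eRk_closure_eq, Set.encard_insert_of_notMem fun hm => hxZ
    ((matroid K E).subset_closure _ (Set.subset_univ _) hm), hZbc] at hle
  have := hle.trans ((matroid_eRk_le_of_le hFK _).trans (hrank t' hT).le)
  exact absurd this (by norm_cast; lia)

end RankCount

section Primitive

open AlgebraicIndependent

variable {E : Type*} [Field E]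

theorem exists_mem_algClosureOf_lt {L : Subfield E} {b : Set E} (hb : b.Finite) {x : ℕ → E}
    (hx : ∀ k, x k ∈ algClosureOf (↑L ∪ b)) :
    ∃ r, x r ∈ algClosureOf (↑L ∪ x '' {k | k < r}) := by
  by_contra! hr
  have hi : AlgebraicIndependent L x := by
    refine algebraicIndependent_of_rank L x id fun r h => hr r (algClosureOf_mono ?_ h)
    exact Set.union_subset_union_right _ (Set.image_mono fun k hk => lt_of_le_of_ne hk.2 hk.1)
  have hind := matroid_indep_image hi Set.univ
  have hsub : x '' Set.univ ⊆ (matroid L E).closure b := by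
    rw [matroid_closure_eq_algClosureOf]
    rintro _ ⟨k, _, rfl⟩
    exact hx k
  have hle := (hind.encard_le_eRk_of_subset hsub).trans
    (((matroid L E).eRk_closure_eq b).le.trans ((matroid L E).eRk_le_encard b))
  rw [hi.injective.encard_image, Set.encard_univ, ENat.card_eq_top_of_infinite, top_le_iff,
    Set.encard_eq_top_iff] at hle
  exact hle hb

theorem mem_algClosureOf_of_mul_add_mem {C N : Subfield E} (hCN : C ≤ N) {a b y : E} (ha : a ∈ N)
    (hb : b ∈ N) (hy : y ∉ algClosureOf (N : Set E)) (h : a * y + b ∈ algClosureOf (↑C ∪ {y})) :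
    a ∈ algClosureOf (C : Set E) := by
  by_contra haC
  have hy0 : y ≠ 0 := by
    rintro rfl
    exact hy (subset_algClosureOf _ N.zero_mem)
  have hU : AlgebraicIndependent N fun _ : Unit => y⁻¹ := by
    rw [algebraicIndependent_iff_notMem_algClosureOf]
    intro _ hmem
    refine hy ?_
    have h' : IsAlgebraic (Subfield.closure (N : Set E)) (y⁻¹)⁻¹ := IsAlgebraic.inv
      (algClosureOf_mono (by simp [Set.subset_def]) hmem)
    rwa [inv_inv] at h'
  have hg : AlgebraicIndependent C fun _ : Unit => a := by
    rw [algebraicIndependent_iff_notMem_algClosureOf]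
    exact fun _ hmem => haC (algClosureOf_mono (by simp [Set.subset_def]) hmem)
  have hs : SpecializesTo N (fun _ : Unit => y⁻¹) (fun _ => 0) (a + b * y⁻¹) a := by
    have h' := (SpecializesTo.of_mem ha).add ((SpecializesTo.of_mem hb).mul
      (SpecializesTo.of_index (G := N) (U := fun _ : Unit => y⁻¹) (c := fun _ => 0) ()))
    rwa [mul_zero, add_zero] at h'
  have hind := algebraicIndependent_sumElim_of_specializesTo hCN hU (fun _ => C.zero_mem)
    (fun _ : Unit => hs) hg
  rw [algebraicIndependent_iff_notMem_algClosureOf] at hind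
  refine hind (Sum.inr ()) ?_
  have hsub : algClosureOf (↑C ∪ {y}) ⊆ algClosureOf (↑C ∪
      Sum.elim (fun _ : Unit => y⁻¹) (fun _ : Unit => a + b * y⁻¹) '' {Sum.inr ()}ᶜ) := by
    refine algClosureOf_subset (Set.union_subset ?_ ?_)
    · exact Set.subset_union_left.trans (subset_algClosureOf _)
    · rw [Set.singleton_subset_iff, ← inv_inv y]
      exact IsAlgebraic.inv (subset_algClosureOf _ (Or.inr ⟨Sum.inl (), by simp, by simp⟩))
  have hyC : y ∈ algClosureOf (↑C ∪ {y}) := subset_algClosureOf _ (Or.inr rfl)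
  have hmul : a + b * y⁻¹ = (a * y + b) * y⁻¹ := by
    field_simp
  have hf := hsub (IsAlgebraic.mul h (IsAlgebraic.inv hyC))
  rwa [← hmul] at hf

theorem iterate_derivation_mul_sub_mem (D : Derivation ℤ E E) {N : Subfield E} (k : ℕ) :
    ∀ {w a : E}, (∀ j < k, D^[j] w ∈ N) → (∀ j, D^[j] a ∈ N) →
      D^[k] (w * a) - a * D^[k] w ∈ N := by
  induction k with
  | zero =>
    intro w a _ _
    simp [mul_comm w a, N.zero_mem]
  | succ k ih =>
    intro w a hw ha
    have h1 := ih (w := w) (a := D a) (fun j hj => hw j (hj.trans (Nat.lt_succ_self k)))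
      fun j => ha (j + 1)
    have h2 := ih (w := D w) (a := a) (fun j hj => hw (j + 1) (Nat.succ_lt_succ hj)) ha
    have h3 := N.add_mem (N.add_mem h1 (N.mul_mem (ha 1) (hw k (Nat.lt_succ_self k)))) h2
    convert h3 using 1
    have hadd : D^[k] (w * D a + a * D w) = D^[k] (w * D a) + D^[k] (a * D w) :=
      iterate_map_add (D : E →ₗ[ℤ] E) k _ _
    rw [Function.iterate_succ_apply, Function.iterate_succ_apply, Derivation.leibniz, smul_eq_mul,
      smul_eq_mul, hadd, Function.iterate_one, mul_comm (D w) a]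
    ring

theorem iterate_mem_algClosureOf [CharZero E] (D : Derivation ℤ E E) {S : Set E}
    (hS : ∀ x ∈ S, D x ∈ algClosureOf S) {x : E} (hx : x ∈ algClosureOf S) (k : ℕ) :
    D^[k] x ∈ algClosureOf S := by
  induction k with
  | zero => exact hx
  | succ k ih =>
    rw [Function.iterate_succ_apply']
    exact derivation_mem_algClosureOf D (subset_algClosureOf S) hS ih

theorem iterate_mem_diffAdjoin {δ : E → E} {F : Subfield E} {S : Set E} {x : E} (hx : x ∈ S)
    (k : ℕ) : δ^[k] x ∈ diffAdjoin δ F S :=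
  Subfield.subset_closure (Or.inr ⟨x, hx, k, rfl⟩)

theorem le_diffAdjoin (δ : E → E) (F : Subfield E) (S : Set E) : F ≤ diffAdjoin δ F S :=
  fun _ hx => Subfield.subset_closure (Or.inl hx)

theorem derivation_mem_diffAdjoin (D : Derivation ℤ E E) {F : Subfield E}
    (hF : ∀ x ∈ F, D x ∈ F) (S : Set E) : ∀ x ∈ diffAdjoin D F S, D x ∈ diffAdjoin D F S := by
  intro x hx
  refine derivation_mem_closure D Subfield.subset_closure ?_ hx
  rintro _ (hx | ⟨s, hs, k, rfl⟩) <;> apply Subfield.subset_closure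
  · exact Or.inl (hF _ hx)
  · exact Or.inr ⟨s, hs, k + 1, Function.iterate_succ_apply' _ _ _⟩

end Primitive

section GenericSystem

variable {E : Type*} [Field E] {n d : ℕ} {s m : Fin (d + 1) → ℕ}

theorem exists_specializesTo_derivatives (D : Derivation ℤ E E) {ξ : Fin n → E} {G : Subfield E}
    (hξ : ∀ l k, D^[k] (ξ l) ∈ G) (hm : ∀ i, 1 ≤ m i)
    (u : (i : Fin (d + 1)) → GenMon n (s i) (m i) → E) {ζ : Fin (d + 1) → E}
    (hζ : ∀ i, ζ i = -∑ α : GenMon n (s i) (m i), u i α * monValue D (s i) (m i) ξ α)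
    (P : Fin (d + 1) → Prop) (e : (j : {j // P j}) → Fin n × Fin (s j + 1)) (F : Subfield E) :
    ∃ c : (Σ i : Fin (d + 1), GenMon n (s i) (m i)) → E, (∀ q, c q ∈ F) ∧
      ∀ j : {j // P j},
        SpecializesTo G (fun q : (Σ i : Fin (d + 1), GenMon n (s i) (m i)) × ℕ =>
          D^[q.2] (u q.1.1 q.1.2)) (fun q => D^[q.2] (c q.1))
          (ζ j) (D^[((e j).2 : ℕ)] (ξ (e j).1)) := by
  classical
  let c : (Σ i : Fin (d + 1), GenMon n (s i) (m i)) → E := fun q =>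
    if ∃ j : {j // P j}, q = ⟨j, GenMon.single (hm j) (e j)⟩ then -1 else 0
  have hc : ∀ (j : {j // P j}) (α : GenMon n (s j) (m j)),
      c ⟨j, α⟩ = if α = GenMon.single (hm j) (e j) then -1 else 0 := by
    intro j α
    refine if_congr ⟨?_, ?_⟩ rfl rfl
    · rintro ⟨j', h⟩
      obtain rfl : j = j' := Subtype.ext (congrArg Sigma.fst h)
      simpa using h
    · rintro rfl
      exact ⟨j, rfl⟩
  refine ⟨c, fun q => ?_, fun j => ?_⟩
  · simp only [c]
    split_ifs
    · exact F.neg_mem F.one_mem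
    · exact F.zero_mem
  · have h := (SpecializesTo.sum Finset.univ fun (α : GenMon n (s j) (m j)) _ =>
      (SpecializesTo.of_index (G := G)
        (U := fun q : (Σ i : Fin (d + 1), GenMon n (s i) (m i)) × ℕ => D^[q.2] (u q.1.1 q.1.2))
        (c := fun q => D^[q.2] (c q.1)) (⟨j, α⟩, 0)).mul
      (SpecializesTo.of_mem (monValue_mem G (fun l k _ => hξ l k) α))).neg
    convert h using 1
    · exact hζ j
    · simp only [Function.iterate_zero, id, hc, ite_mul, zero_mul, Finset.sum_ite_eq',
        Finset.mem_univ, if_true, monValue_single]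
      ring

theorem iterate_derivation_mem_closure_derivSet (D : Derivation ℤ E E) {K : Subfield E}
    (hK : ∀ x ∈ K, D x ∈ K) {ξ : Fin n → E} {x : E} {t : ℕ}
    (hx : x ∈ Subfield.closure (↑K ∪ derivSet D ξ t)) (k : ℕ) :
    D^[k] x ∈ Subfield.closure (↑K ∪ derivSet D ξ (k + t)) := by
  induction k with
  | zero => simpa using hx
  | succ k ih =>
    rw [Function.iterate_succ_apply', Nat.add_right_comm]
    refine derivation_mem_closure D ?_ ?_ ih
    · refine Set.Subset.trans ?_ Subfield.subset_closure
      exact Set.union_subset_union_right _ (derivSet_mono _ _ (Nat.le_succ _))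
    · rintro _ (hy | ⟨i, j, hj, rfl⟩) <;> apply Subfield.subset_closure
      · exact Or.inl (hK _ hy)
      · exact Or.inr ⟨i, j + 1, Nat.succ_le_succ hj, Function.iterate_succ_apply' _ _ _⟩

theorem entry_mem_algClosureOf (D : Derivation ℤ E E) {F : Subfield E}
    (hF : ∀ x ∈ F, D x ∈ F) {ξ : Fin n → E} (hm : ∀ i, 1 ≤ m i)
    {u : (i : Fin (d + 1)) → GenMon n (s i) (m i) → E}
    (hu : DiffIndep D (diffAdjoin D F (Set.range ξ))
      (fun q : Σ i : Fin (d + 1), GenMon n (s i) (m i) => u q.1 q.2))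
    {ζ : Fin (d + 1) → E}
    (hζ : ∀ i, ζ i = -∑ α : GenMon n (s i) (m i), u i α * monValue D (s i) (m i) ξ α)
    {i : Fin (d + 1)} {L : Subfield E}
    (hL : L = diffAdjoin D (diffAdjoin D F {x | ∃ i α, u i α = x})
      {x | ∃ j : Fin (d + 1), j ≠ i ∧ ζ j = x}) {r : ℕ}
    (hr : D^[r] (ζ i) ∈ algClosureOf (↑L ∪ (fun k => D^[k] (ζ i)) '' {k | k < r})) (l : Fin n) :
    ξ l ∈ algClosureOf (↑L ∪ {x : E | ∃ k : ℕ, D^[k] (ζ i) = x}) := by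
  classical
  let Q := Σ i : Fin (d + 1), GenMon n (s i) (m i)
  let G := diffAdjoin D F (Set.range ξ)
  let U : Q × ℕ → E := fun q => D^[q.2] (u q.1.1 q.1.2)
  let α₀ : GenMon n (s i) (m i) := GenMon.single (hm i) (l, 0)
  let q₀ : Q := ⟨i, α₀⟩
  let w := u i α₀
  let rest := U '' {(q₀, r)}ᶜ
  let N := Subfield.closure (↑G ∪ rest)
  let N' := diffAdjoin D G {x | ∃ q : Q, q ≠ q₀ ∧ u q.1 q.2 = x}
  let A := {x | ∃ j : Fin (d + 1), j ≠ i ∧ ∃ k : ℕ, D^[k] (ζ j) = x}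
  let B := (fun k => D^[k] (ζ i)) '' {k | k < r}
  let C := Subfield.closure (↑F ∪ rest ∪ (A ∪ B))
  have hGD : ∀ x ∈ G, D x ∈ G := derivation_mem_diffAdjoin D hF _
  have hξG : ∀ l k, D^[k] (ξ l) ∈ G := fun l k => iterate_mem_diffAdjoin (Set.mem_range_self l) k
  have hGN : G ≤ N := fun x hx => Subfield.subset_closure (Or.inl hx)
  have hN'N : N' ≤ N := by
    refine Subfield.closure_le.2 (Set.union_subset hGN ?_)
    rintro _ ⟨_, ⟨q, hq, rfl⟩, k, rfl⟩
    exact Subfield.subset_closure (Or.inr ⟨(q, k), fun e => hq (congrArg Prod.fst e), rfl⟩)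
  have hN'D : ∀ x ∈ N', D x ∈ N' := derivation_mem_diffAdjoin D hGD _
  have hGN' : G ≤ N' := le_diffAdjoin D G _
  have hterm : ∀ q : Q, q ≠ q₀ → u q.1 q.2 * monValue D (s q.1) (m q.1) ξ q.2 ∈ N' := by
    intro q hq
    exact N'.mul_mem (iterate_mem_diffAdjoin (δ := D)
      (show u q.1 q.2 ∈ {x | ∃ q : Q, q ≠ q₀ ∧ u q.1 q.2 = x} from ⟨q, hq, rfl⟩) 0)
      (hGN' (monValue_mem G (fun l k _ => hξG l k) _))
  have hζj : ∀ j, j ≠ i → ζ j ∈ N' := by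
    intro j hj
    rw [hζ j]
    exact N'.neg_mem (N'.sum_mem fun α _ => hterm ⟨j, α⟩ fun e => hj (congrArg Sigma.fst e))
  have hβ : w * ξ l + ζ i ∈ N' := by
    have hsum : ∑ α : GenMon n (s i) (m i), u i α * monValue D (s i) (m i) ξ α =
        w * ξ l + ∑ α ∈ Finset.univ.erase α₀, u i α * monValue D (s i) (m i) ξ α := by
      rw [← Finset.add_sum_erase _ _ (Finset.mem_univ α₀)]
      simp only [α₀, w, monValue_single]
      rfl
    rw [hζ i, hsum, neg_add, add_neg_cancel_left]
    refine N'.neg_mem (N'.sum_mem fun α hα => hterm ⟨i, α⟩ fun e => ?_)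
    exact (Finset.mem_erase.1 hα).1 (eq_of_heq (Sigma.mk.inj_iff.1 e).2)
  have hw : ∀ k, D^[k] (w * ξ l) + D^[k] (ζ i) ∈ N := by
    intro k
    have h := hN'N (iterate_mem hN'D hβ k)
    rwa [show D^[k] (w * ξ l + ζ i) = _ from iterate_map_add (D : E →ₗ[ℤ] E) k _ _] at h
  have hwN : ∀ k, k < r → D^[k] w ∈ N := fun k hk =>
    Subfield.subset_closure (Or.inr ⟨(q₀, k), fun e => hk.ne (congrArg Prod.snd e), rfl⟩)
  have hsub : ∀ k ≤ r, ξ l * D^[k] w + D^[k] (ζ i) ∈ N := by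
    intro k hk
    have h := N.sub_mem (hw k) (iterate_derivation_mul_sub_mem D k
      (fun j hj => hwN j (hj.trans_le hk)) fun j => hGN (hξG l j))
    convert h using 1
    ring
  have hCN : C ≤ N := by
    refine Subfield.closure_le.2 (Set.union_subset (Set.union_subset ?_ ?_)
      (Set.union_subset ?_ ?_))
    · exact fun x hx => hGN (le_diffAdjoin D F _ hx)
    · exact Set.subset_union_right.trans Subfield.subset_closure
    · rintro _ ⟨j, hj, k, rfl⟩
      exact hN'N (iterate_mem hN'D (hζj j hj) k)
    · rintro _ ⟨k, hk, rfl⟩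
      have h := N.sub_mem (hsub k (le_of_lt hk))
        (N.mul_mem (hGN (hξG l 0)) (hwN k hk))
      simpa using h
  have hU : ∀ p : Q × ℕ, p ≠ (q₀, r) → U p ∈ C := fun p hp =>
    Subfield.subset_closure (Or.inl (Or.inr ⟨p, hp, rfl⟩))
  have hy : D^[r] w ∉ algClosureOf (N : Set E) := by
    have h := (algebraicIndependent_iff_notMem_algClosureOf _ _).1 hu (q₀, r)
    refine fun hN => h ?_
    exact algClosureOf_subset (closure_subset_algClosureOf _) hN
  have hKL : (diffAdjoin D F {x | ∃ i α, u i α = x} : Set E) ⊆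
      algClosureOf (↑C ∪ {D^[r] w}) := by
    refine (closure_subset_algClosureOf _).trans (algClosureOf_subset
      (Set.Subset.trans (Set.union_subset ?_ ?_) (subset_algClosureOf _)))
    · exact fun x hx => Or.inl (Subfield.subset_closure (Or.inl (Or.inl hx)))
    · rintro _ ⟨_, ⟨j, α, rfl⟩, k, rfl⟩
      by_cases hjk : ((⟨j, α⟩, k) : Q × ℕ) = (q₀, r)
      · right
        have : U (⟨j, α⟩, k) = U (q₀, r) := congrArg U hjk
        exact this
      · exact Or.inl (hU _ hjk)
  have hLC : algClosureOf (↑L ∪ B) ⊆ algClosureOf (↑C ∪ {D^[r] w}) := by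
    refine algClosureOf_subset (Set.union_subset ?_ ?_)
    · rw [hL]
      refine (closure_subset_algClosureOf _).trans (algClosureOf_subset (Set.union_subset hKL ?_))
      rintro _ ⟨_, ⟨j, hj, rfl⟩, k, rfl⟩
      exact subset_algClosureOf _
        (Or.inl (Subfield.subset_closure (Or.inr (Or.inl ⟨j, hj, k, rfl⟩))))
    · exact fun x hx => subset_algClosureOf _
        (Or.inl (Subfield.subset_closure (Or.inr (Or.inr hx))))
  have hneg : ξ l * D^[r] w + -(ξ l * D^[r] w + D^[r] (ζ i)) ∈ algClosureOf (↑C ∪ {D^[r] w}) := by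
    rw [neg_add, add_neg_cancel_left]
    exact IsAlgebraic.neg (hLC hr)
  have hC := mem_algClosureOf_of_mul_add_mem hCN (hGN (hξG l 0)) (N.neg_mem (hsub r le_rfl)) hy hneg
  refine algClosureOf_subset ((closure_subset_algClosureOf _).trans (algClosureOf_subset
    (Set.Subset.trans ?_ (subset_algClosureOf _)))) hC
  have hKL' : diffAdjoin D F {x | ∃ i α, u i α = x} ≤ L := hL ▸ le_diffAdjoin D _ _
  refine Set.union_subset (Set.union_subset ?_ ?_) (Set.union_subset ?_ ?_)
  · exact fun x hx => Or.inl (hKL' (le_diffAdjoin D F _ hx))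
  · rintro _ ⟨p, _, rfl⟩
    exact Or.inl (hKL' (iterate_mem_diffAdjoin (show u p.1.1 p.1.2 ∈ {x | ∃ i α, u i α = x} from
      ⟨_, _, rfl⟩) _))
  · rintro _ ⟨j, hj, k, rfl⟩
    rw [hL]
    exact Or.inl (iterate_mem_diffAdjoin (show ζ j ∈ {x | ∃ j : Fin (d + 1), j ≠ i ∧ ζ j = x} from
      ⟨j, hj, rfl⟩) k)
  · rintro _ ⟨k, _, rfl⟩
    exact Or.inr ⟨k, rfl⟩

end GenericSystem

section ChowForm

open AlgebraicIndependent

/-- Independence over `F` of specialized elements lifts to independence over the differential field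
generated by the generic coefficients. -/
theorem algebraicIndependent_of_specializesTo {E Q ι : Type*} [Field E] {δ : E → E}
    {F G : Subfield E} (hFG : F ≤ G) (hF : ∀ x ∈ F, δ x ∈ F) {u : Q → E} (hu : DiffIndep δ G u)
    {S : Set E} (hS : S ⊆ Set.range u) {c : Q → E} (hc : ∀ q, c q ∈ F) {f g : ι → E}
    (hfg : ∀ i, SpecializesTo G (fun q : Q × ℕ => δ^[q.2] (u q.1)) (fun q => δ^[q.2] (c q.1))
      (f i) (g i))
    (hg : AlgebraicIndependent F g) : AlgebraicIndependent (diffAdjoin δ F S) f := by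
  refine (algebraicIndependent_sumElim_of_specializesTo hFG hu
    (fun q => iterate_mem hF (hc q.1) q.2) hfg hg).of_sumElim_of_subset ?_
  refine (closure_subset_algClosureOf _).trans
    (algClosureOf_mono (Set.union_subset_union_right _ ?_))
  rintro _ ⟨_, hs, k, rfl⟩
  obtain ⟨q, rfl⟩ := hS hs
  exact ⟨(q, k), rfl⟩

end ChowForm

/-- **Orders of the generalized differential Chow form.**
Let `ξ` have differential dimension `d` and order `h` over `F`, let the combined family
`(u_{iα})` of coefficients of `d+1` generic differential polynomials of orders `sᵢ` and
degrees `mᵢ` be differentially independent over `F⟨ξ₁,…,ξₙ⟩`, set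
`ζᵢ = −∑_α u_{iα} ξ^α` and `K = F⟨u_{iα}⟩`.  Then for each `i`, the transcendence
degree of `K⟨ζ₀,…,ζ_d⟩` over `K⟨ζⱼ : j ≠ i⟩` equals `h + s − sᵢ` where
`s = s₀ + ⋯ + s_d` (expressed without subtraction as `h + ∑_{j≠i} sⱼ`). -/
theorem generalized_chow_form_order
    {E : Type*} [Field E] [CharZero E] (δ : E → E)
    (hδadd : ∀ a b : E, δ (a + b) = δ a + δ b)
    (hδmul : ∀ a b : E, δ (a * b) = a * δ b + δ a * b)
    (F : Subfield E) (hF : ∀ x ∈ F, δ x ∈ F)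
    (n d h : ℕ) (ξ : Fin n → E)
    (hdim : HasDimOrder δ F ξ d h)
    (s m : Fin (d + 1) → ℕ) (hm : ∀ i, 1 ≤ m i)
    (u : (i : Fin (d + 1)) → GenMon n (s i) (m i) → E)
    (hu : DiffIndep δ (diffAdjoin δ F (Set.range ξ))
      (fun q : Σ i : Fin (d + 1), GenMon n (s i) (m i) => u q.1 q.2))
    (ζ : Fin (d + 1) → E)
    (hζ : ∀ i, ζ i = -∑ α : GenMon n (s i) (m i), u i α * monValue δ (s i) (m i) ξ α) :
    ∀ i : Fin (d + 1),
      Trdeg (diffAdjoin δ (diffAdjoin δ F {x | ∃ i α, u i α = x})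
          {x | ∃ j : Fin (d + 1), j ≠ i ∧ ζ j = x})
        (IntermediateField.adjoin
          (diffAdjoin δ (diffAdjoin δ F {x | ∃ i α, u i α = x})
            {x | ∃ j : Fin (d + 1), j ≠ i ∧ ζ j = x})
          {x : E | ∃ k : ℕ, δ^[k] (ζ i) = x})
      = ((h + ∑ j ∈ Finset.univ.erase i, s j : ℕ) : Cardinal) := by
  classical
  obtain ⟨D, rfl⟩ : ∃ D : Derivation ℤ E E, ⇑D = δ :=
    ⟨Derivation.mk' (AddMonoidHom.mk' δ hδadd).toIntLinearMap fun a b => by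
      change δ (a * b) = a * δ b + b * δ a
      rw [hδmul, mul_comm (δ a)], rfl⟩
  intro i
  have hcard : Fintype.card {j : Fin (d + 1) // j ≠ i} = d := by
    simp [Fintype.card_subtype_compl]
  have hsum : ∑ j : {j : Fin (d + 1) // j ≠ i}, s j = ∑ j ∈ Finset.univ.erase i, s j :=
    (Finset.sum_subtype _ (by simp) s).symm
  have hdim' : HasDimOrder D F ξ (Fintype.card {j : Fin (d + 1) // j ≠ i}) h := by
    rw [hcard]
    exact hdim
  obtain ⟨l, T, hrank, hind₀, hindT⟩ := hdim'.exists_indices D hF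
  have hT : T ≤ T + ∑ j, s j := Nat.le_add_right _ _
  have hsT : ∀ j, s j ≤ T + ∑ j, s j := fun j =>
    (Finset.single_le_sum (fun _ _ => Nat.zero_le _) (Finset.mem_univ j)).trans
      (Nat.le_add_left _ _)
  generalize T + ∑ j, s j = t at hT hsT
  obtain ⟨I, hI⟩ := (AlgebraicIndependent.matroid F E).exists_isBasis (derivSet D ξ t)
  have hFG := le_diffAdjoin D F (Set.range ξ)
  have hξG : ∀ l k, D^[k] (ξ l) ∈ diffAdjoin D F (Set.range ξ) :=
    fun l k => iterate_mem_diffAdjoin (Set.mem_range_self l) k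
  have hGD := derivation_mem_diffAdjoin D hF (Set.range ξ)
  have hSu : {x | ∃ i α, u i α = x} ⊆
      Set.range fun q : Σ i : Fin (d + 1), GenMon n (s i) (m i) => u q.1 q.2 := by
    rintro _ ⟨i, α, rfl⟩
    exact ⟨⟨i, α⟩, rfl⟩
  have hζ₀ : AlgebraicIndependent (diffAdjoin D F {x | ∃ i α, u i α = x})
      fun p : {j : Fin (d + 1) // j ≠ i} × ℕ => D^[p.2] (ζ p.1) := by
    obtain ⟨c, hc, hcζ⟩ := exists_specializesTo_derivatives D hξG hm u hζ (· ≠ i)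
      (fun j => (l j, 0)) F
    refine algebraicIndependent_of_specializesTo hFG hF hu hSu hc (fun p => ?_) hind₀
    simpa only [Fin.val_zero, Function.iterate_zero_apply] using
      SpecializesTo.iterate_derivation
        (u := fun q : Σ i : Fin (d + 1), GenMon n (s i) (m i) => u q.1 q.2) D hGD (hcζ p.1) p.2
  have hζI : AlgebraicIndependent (diffAdjoin D F {x | ∃ i α, u i α = x})
      (Sum.elim ((↑) : I → E) fun p : {j : Fin (d + 1) // j ≠ i} × ℕ =>
        D^[t + 1 - s p.1 + p.2] (ζ p.1)) := by
    obtain ⟨c, hc, hcζ⟩ := exists_specializesTo_derivatives D hξG hm u hζ (· ≠ i)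
      (fun j => (l j, Fin.last (s j))) F
    refine algebraicIndependent_of_specializesTo hFG hF hu hSu hc ?_ (hindT t hT I hI)
    rintro (b | p)
    · obtain ⟨l, k, _, hb⟩ := hI.subset b.2
      have hbG : (b : E) ∈ diffAdjoin D F (Set.range ξ) := hb ▸ hξG l k
      exact SpecializesTo.of_mem hbG
    · have hp := SpecializesTo.iterate_derivation
        (u := fun q : Σ i : Fin (d + 1), GenMon n (s i) (m i) => u q.1 q.2) D hGD (hcζ p.1)
        (t + 1 - s p.1 + p.2)
      have hk : t + 1 - s p.1 + p.2 + s p.1 = t + 1 + p.2 := by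
        have := hsT p.1
        lia
      simpa only [Fin.val_last, ← Function.iterate_add_apply, hk, Sum.elim_inr] using hp
  generalize hK : diffAdjoin D F {x | ∃ i α, u i α = x} = K at hζ₀ hζI
  have hFK : F ≤ K := hK ▸ le_diffAdjoin D F _
  have hKD : ∀ x ∈ K, D x ∈ K := hK ▸ derivation_mem_diffAdjoin D hF _
  have hmem : ∀ j k, D^[k] (ζ j) ∈ algClosureOf (↑K ∪ derivSet D ξ (k + s j)) := by
    intro j k
    refine closure_subset_algClosureOf _ (iterate_derivation_mem_closure_derivSet D hKD ?_ k)
    rw [hζ j]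
    refine Subfield.neg_mem _ (Subfield.sum_mem _ fun α _ => Subfield.mul_mem _ ?_ ?_)
    · refine Subfield.subset_closure (Or.inl ?_)
      rw [← hK]
      exact Subfield.subset_closure (Or.inr ⟨u j α, ⟨j, α, rfl⟩, 0, rfl⟩)
    · refine monValue_mem _ (fun l k hk => ?_) α
      exact Subfield.subset_closure (Or.inr ⟨l, k, hk, rfl⟩)
  obtain ⟨b, hb, hbc, hbζ⟩ := exists_complement_derivatives
    (J := {j : Fin (d + 1) // j ≠ i}) (s := fun j => s j) (ζ := fun j => ζ j) hFK
    (fun j => hsT j) (hrank t hT) (fun j => hmem j) hζ₀ hI hζI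
  generalize hL : diffAdjoin D K {x | ∃ j : Fin (d + 1), j ≠ i ∧ ζ j = x} = L
  have hKL : K ≤ L := hL ▸ le_diffAdjoin D K _
  have hLD : ∀ x ∈ L, D x ∈ L := hL ▸ derivation_mem_diffAdjoin D hKD _
  have hLζ : ∀ (j : {j : Fin (d + 1) // j ≠ i}) k, D^[k] (ζ j) ∈ L := by
    intro j k
    rw [← hL]
    exact Subfield.subset_closure (Or.inr ⟨ζ j, ⟨j, j.2, rfl⟩, k, rfl⟩)
  have hspan : ∀ t, derivSet D ξ t ⊆ algClosureOf (↑L ∪ b) :=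
    derivSet_subset_of_complement (J := {j : Fin (d + 1) // j ≠ i}) (s := fun j => s j)
      (ζ := fun j => ζ j) hFK hKL hLζ (fun j => hsT j) (fun t' ht' => hrank t' (hT.trans ht'))
      (fun j => hmem j) hb hbc hbζ
  have hζb : ∀ k, D^[k] (ζ i) ∈ algClosureOf (↑L ∪ b) := fun k =>
    algClosureOf_subset (Set.union_subset ((Set.subset_union_of_subset_left hKL b).trans
      (subset_algClosureOf _)) (hspan _)) (hmem i k)
  obtain ⟨r, hr⟩ := exists_mem_algClosureOf_lt (Set.finite_of_encard_eq_coe hbc) hζb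
  have hξL := entry_mem_algClosureOf D hF hm hu hζ (i := i) (L := L) (by rw [hK, hL]) hr
  have hstable : ∀ x ∈ (↑L ∪ {x : E | ∃ k : ℕ, D^[k] (ζ i) = x} : Set E),
      D x ∈ algClosureOf (↑L ∪ {x : E | ∃ k : ℕ, D^[k] (ζ i) = x}) := by
    rintro _ (hx | ⟨k, rfl⟩) <;> apply subset_algClosureOf
    · exact Or.inl (hLD _ hx)
    · exact Or.inr ⟨k + 1, Function.iterate_succ_apply' _ _ _⟩
  have hbL : AlgebraicIndependent L ((↑) : b → E) := by
    refine hbζ.of_sumElim_of_subset ?_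
    rw [← hL]
    refine (closure_subset_algClosureOf _).trans
      (algClosureOf_mono (Set.union_subset_union_right _ ?_))
    rintro _ ⟨_, ⟨j, hj, rfl⟩, k, rfl⟩
    exact ⟨(⟨j, hj⟩, k), rfl⟩
  rw [trdeg_adjoin_eq_natCast_iff, ← hsum, ← hbc,
    ← (AlgebraicIndependent.matroid_indep_iff.2 hbL).eRk_eq_encard]
  refine le_antisymm ?_ ?_
  · rw [← Matroid.eRk_closure_eq _ b, matroid_closure_eq_algClosureOf]
    refine Matroid.eRk_mono _ ?_
    rintro _ ⟨k, rfl⟩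
    exact hζb k
  · rw [← Matroid.eRk_closure_eq _ {x : E | ∃ k : ℕ, D^[k] (ζ i) = x},
      matroid_closure_eq_algClosureOf]
    refine Matroid.eRk_mono _ (hb.trans ?_)
    rintro _ ⟨l, k, _, rfl⟩
    exact iterate_mem_algClosureOf D hstable (hξL l) k
end

section
/- In the Chow-form evaluation setup, assume f ∈ R is irreducible, ev(f) = 0, every g ∈ R with ev(g) = 0 is divisible by f in R, and ∂f/∂z_0^{(h)} ≠ 0 (so f has order exactly h in z_0). Then: (a) for any ρ' ≠ τ' in {0,…,d}, the polynomial f* obtained from f by exchanging the indeterminates u_{ρ'j}^{(k)} ↔ u_{τ'j}^{(k)} and z_{ρ'}^{(k)} ↔ z_{τ'}^{(k)} (for all j, k) satisfies f* = f or f* = −f; (b) ∂f/∂z_σ^{(h)} ≠ 0 for every σ ∈ {0,…,d}; (c) for each j ∈ {1,…,n}: one has ∂f/∂u_{σj}^{(k)} = 0 for all σ and all k (i.e., no u_{σj}^{(k)} occurs in f) if and only if ξ_j = 0, and if ξ_j ≠ 0 then ∂f/∂u_{σj}^{(h)} ≠ 0 for every σ (every variable block u_{σj} that occurs in f occurs with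 order exactly h). -/
set_option synthInstance.maxHeartbeats 1000000
set_option maxHeartbeats 1000000

namespace ChowForm

open MvPolynomial

section Polynomial

variable {ι R A : Type*}

/-- A nonzero partial derivative has smaller degree in the variable of differentiation. -/
theorem pderiv_eq_zero_of_dvd [CommRing R] [IsDomain R] {f : MvPolynomial ι R} (i : ι)
    (hf : f ∣ pderiv i f) : pderiv i f = 0 := by
  by_contra hne
  have key : ∀ m ∈ (pderiv i f).support, m i < degreeOf i f := by
    intro m hm
    have hm' : m + Finsupp.single i 1 ∈ f.support := by
      rw [mem_support_iff, coeff_pderiv] at hm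
      exact mem_support_iff.2 (left_ne_zero_of_mul hm)
    have := monomial_le_degreeOf i hm'
    simp only [Finsupp.add_apply, Finsupp.single_eq_same] at this
    omega
  obtain ⟨q, hq⟩ := hf
  obtain ⟨m, hm⟩ := support_nonempty.2 hne
  have hlt := (degreeOf_lt_iff (Nat.zero_lt_of_lt (key m hm))).2 key
  rw [hq] at hne hlt
  rw [degreeOf_mul_eq (left_ne_zero_of_mul hne) (right_ne_zero_of_mul hne)] at hlt
  omega

/-- The chain rule for a derivation that vanishes on the coefficients. -/
theorem derivation_eval₂Hom [Fintype ι] [CommRing R] [CommRing A] (D : Derivation ℤ A A)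
    (φ : R →+* A) (hφ : ∀ r, D (φ r) = 0) (x : ι → A) (p : MvPolynomial ι R) :
    D (eval₂Hom φ x p) = ∑ i, eval₂Hom φ x (pderiv i p) * D (x i) := by
  classical
  induction p using MvPolynomial.induction_on with
  | C a => simp [hφ]
  | add p q hp hq => simp only [map_add, hp, hq, add_mul, Finset.sum_add_distrib]
  | mul_X p i hp =>
    simp only [map_mul, Derivation.leibniz, hp, smul_eq_mul, map_add, pderiv_X, add_mul,
      Finset.sum_add_distrib, Finset.mul_sum, eval₂Hom_X']
    congr 1
    · rw [Finset.sum_eq_single i]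
      · simp
      · intro b _ hb
        simp [hb.symm]
      · simp
    · exact Finset.sum_congr rfl fun _ _ => by ring

/-- If `f` divides its image under an involution of the variables, then the two agree up to
sign. -/
theorem rename_eq_or_eq_neg_of_dvd [CommRing R] [IsDomain R] {f : MvPolynomial ι R} (hf : f ≠ 0)
    (e : ι ≃ ι) (he : ∀ i, e (e i) = i) (hdvd : f ∣ rename e f) :
    rename e f = f ∨ rename e f = -f := by
  obtain ⟨q, hq⟩ := hdvd
  have hne : rename e f ≠ 0 := (rename_injective e e.injective).ne_iff' (map_zero _) |>.2 hf
  have hq0 : q ≠ 0 := by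
    rintro rfl
    exact hne (by simpa using hq)
  have hdeg := totalDegree_renameEquiv e f
  rw [renameEquiv_apply, hq, totalDegree_mul_of_isDomain hf hq0, Nat.add_eq_left,
    totalDegree_eq_zero_iff_eq_C] at hdeg
  generalize coeff 0 q = c at hdeg
  have h2 : rename e (rename e f) = f := by
    rw [rename_rename, show (e ∘ e : ι → ι) = id from funext he, rename_id_apply]
  rw [hq, hdeg, map_mul, rename_C, hq, hdeg, mul_assoc] at h2
  have hc : (C c * C c : MvPolynomial ι R) = 1 :=
    mul_left_cancel₀ hf (by rw [h2, mul_one])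
  rw [hq, hdeg]
  rcases mul_self_eq_one_iff.1 hc with hc | hc <;> simp [hc]

end Polynomial

/-- The general Leibniz rule for an iterated derivation. -/
theorem iterate_mul {A : Type*} [CommRing A] (D : Derivation ℤ A A) (k : ℕ) (a b : A) :
    D^[k] (a * b) =
      ∑ ij ∈ Finset.HasAntidiagonal.antidiagonal k, k.choose ij.1 • (D^[ij.1] a * D^[ij.2] b) := by
  induction k with
  | zero => simp
  | succ k ih =>
    rw [Finset.sum_antidiagonal_choose_succ_nsmul (fun i j => D^[i] a * D^[j] b) k]
    simp only [Function.iterate_succ_apply', ih, map_sum, map_nsmul, Derivation.leibniz,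
      smul_add, Finset.sum_add_distrib, smul_eq_mul]
    congr 1
    refine Finset.sum_congr rfl fun ⟨i, j⟩ hij => ?_
    rw [k.choose_symm_of_eq_add (Finset.HasAntidiagonal.mem_antidiagonal.1 hij).symm, mul_comm]

section Generic

variable {R A : Type*} [CommRing R] [CommRing A] {n d h : ℕ}

/-- The evaluation point of the Chow form with the derivatives of the coefficients `u` taken as
indeterminates; `η j b` stands for the `b`-th derivative of `ξ j`. -/
noncomputable def genericPoint (d h : ℕ) (η : Fin n → ℕ → A) :
    (Fin (d + 1) × Fin n × Fin (h + 1)) ⊕ (Fin (d + 1) × Fin (h + 1)) →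
      MvPolynomial ((Fin (d + 1) × Fin n) × ℕ) A :=
  Sum.elim (fun q => X ((q.1, q.2.1), (q.2.2 : ℕ)))
    (fun q => -∑ ρ : Fin n, ∑ ij ∈ Finset.HasAntidiagonal.antidiagonal (q.2 : ℕ),
      (q.2 : ℕ).choose ij.1 • (X ((q.1, ρ), ij.1) * C (η ρ ij.2)))

/-- Evaluation at `genericPoint`. -/
noncomputable def genericEval (d h : ℕ) (φ : R →+* A) (η : Fin n → ℕ → A) :
    MvPolynomial ((Fin (d + 1) × Fin n × Fin (h + 1)) ⊕ (Fin (d + 1) × Fin (h + 1))) R →+*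
      MvPolynomial ((Fin (d + 1) × Fin n) × ℕ) A :=
  eval₂Hom (C.comp φ) (genericPoint d h η)

/-- Permutation of the blocks of variables. -/
def blockPerm (h n : ℕ) (s : Equiv.Perm (Fin (d + 1))) :
    Equiv.Perm ((Fin (d + 1) × Fin n × Fin (h + 1)) ⊕ (Fin (d + 1) × Fin (h + 1))) :=
  Equiv.sumCongr (s.prodCongr (Equiv.refl _)) (s.prodCongr (Equiv.refl _))

theorem genericEval_rename_blockPerm (φ : R →+* A) (η : Fin n → ℕ → A)
    (s : Equiv.Perm (Fin (d + 1)))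
    (f : MvPolynomial ((Fin (d + 1) × Fin n × Fin (h + 1)) ⊕ (Fin (d + 1) × Fin (h + 1))) R) :
    genericEval d h φ η (rename (blockPerm h n s) f) =
      rename (fun p : (Fin (d + 1) × Fin n) × ℕ => ((s p.1.1, p.1.2), p.2))
        (genericEval d h φ η f) := by
  induction f using MvPolynomial.induction_on with
  | C a => simp [genericEval]
  | add p q hp hq => simp only [map_add, hp, hq]
  | mul_X p i hp =>
    simp only [map_mul, hp, rename_X]
    congr 1
    rcases i with ⟨σ, j, k⟩ | ⟨σ, k⟩ <;>
      simp [genericEval, genericPoint, blockPerm]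

theorem pderiv_genericPoint_inl (η : Fin n → ℕ → A) (σ : Fin (d + 1)) (j : Fin n)
    (k : Fin (h + 1)) (q : Fin (d + 1) × Fin n × Fin (h + 1)) :
    pderiv ((σ, j), (k : ℕ)) (genericPoint d h η (Sum.inl q)) =
      if q = (σ, j, k) then 1 else 0 := by
  obtain ⟨σ', j', k'⟩ := q
  simp [genericPoint, pderiv_X, Pi.single_apply, Fin.ext_iff, and_assoc, eq_comm]

theorem pderiv_genericPoint_inr (η : Fin n → ℕ → A) (σ : Fin (d + 1)) (j : Fin n)
    (k : ℕ) (q : Fin (d + 1) × Fin (h + 1)) :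
    pderiv ((σ, j), k) (genericPoint d h η (Sum.inr q)) =
      if σ = q.1 then -∑ ij ∈ Finset.HasAntidiagonal.antidiagonal (q.2 : ℕ),
        if k = ij.1 then (q.2 : ℕ).choose ij.1 • C (η j ij.2) else 0
      else 0 := by
  obtain ⟨σ', k'⟩ := q
  simp only [genericPoint, Sum.elim_inr, map_neg, map_sum, map_nsmul, pderiv_mul, pderiv_C,
    mul_zero, add_zero, pderiv_X, Pi.single_apply, Prod.mk.injEq]
  rw [Finset.sum_eq_single j]
  · split_ifs with hσ
    · refine congrArg Neg.neg (Finset.sum_congr rfl fun ij _ => ?_)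
      simp [hσ, eq_comm]
    · simp [Ne.symm hσ]
  · intro b _ hb
    simp [hb]
  · simp

/-- Differentiating a relation in the highest derivative of `u σ j`. -/
theorem pderiv_genericEval_last (φ : R →+* A) (η : Fin n → ℕ → A) (σ : Fin (d + 1)) (j : Fin n)
    (f : MvPolynomial ((Fin (d + 1) × Fin n × Fin (h + 1)) ⊕ (Fin (d + 1) × Fin (h + 1))) R) :
    pderiv ((σ, j), h) (genericEval d h φ η f) =
      genericEval d h φ η (pderiv (Sum.inl (σ, j, Fin.last h)) f) -
        genericEval d h φ η (pderiv (Sum.inr (σ, Fin.last h)) f) * C (η j 0) := by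
  have := derivation_eval₂Hom ((pderiv ((σ, j), h)).restrictScalars ℤ) (C.comp φ)
    (fun r => by simp) (genericPoint d h η) f
  simp only [Derivation.restrictScalars_apply] at this
  rw [genericEval, this, Fintype.sum_sum_type, sub_eq_add_neg]
  congr 1
  · have hl := pderiv_genericPoint_inl η σ j (Fin.last h)
    rw [Fin.val_last] at hl
    simp [hl]
  · rw [Finset.sum_eq_single (σ, Fin.last h)]
    · rw [pderiv_genericPoint_inr, if_pos rfl, Finset.sum_eq_single (h, 0)]
      · simp
      · rintro ⟨a, b⟩ hab hne
        rw [Finset.HasAntidiagonal.mem_antidiagonal, Fin.val_last] at hab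
        refine if_neg fun ha => hne ?_
        dsimp only at hab ha
        rw [Prod.mk.injEq]
        omega
      · simp
    · rintro ⟨σ', k⟩ _ hne
      rw [pderiv_genericPoint_inr]
      split_ifs with hσ
      · rw [Finset.sum_eq_zero, neg_zero, mul_zero]
        rintro ⟨a, b⟩ hab
        refine if_neg fun ha => hne ?_
        rw [Finset.HasAntidiagonal.mem_antidiagonal] at hab
        dsimp only at hab ha hσ
        have := k.isLt
        rw [Prod.mk.injEq, Fin.ext_iff (a := k), Fin.val_last]
        exact ⟨hσ.symm, by omega⟩
      · rw [mul_zero]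
    · simp

/-- If `ξ j` and its derivatives vanish, only `u σ j` itself contributes to the derivative of a
relation. -/
theorem pderiv_genericEval_of_eq_zero (φ : R →+* A) (η : Fin n → ℕ → A) (σ : Fin (d + 1))
    (j : Fin n) (hj : ∀ b, η j b = 0) (k : Fin (h + 1))
    (f : MvPolynomial ((Fin (d + 1) × Fin n × Fin (h + 1)) ⊕ (Fin (d + 1) × Fin (h + 1))) R) :
    pderiv ((σ, j), (k : ℕ)) (genericEval d h φ η f) =
      genericEval d h φ η (pderiv (Sum.inl (σ, j, k)) f) := by
  have := derivation_eval₂Hom ((pderiv ((σ, j), (k : ℕ))).restrictScalars ℤ) (C.comp φ)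
    (fun r => by simp) (genericPoint d h η) f
  simp only [Derivation.restrictScalars_apply] at this
  rw [genericEval, this, Fintype.sum_sum_type]
  simp [pderiv_genericPoint_inl, pderiv_genericPoint_inr, hj]

end Generic

end ChowForm

/-- **Symmetry and order properties of the differential Chow form.**
In the Chow-form evaluation setup, suppose `f` is irreducible, `ev f = 0`, `f` divides
every polynomial killed by `ev`, and `∂f/∂z₀^{(h)} ≠ 0`.  Then:
(a) exchanging the variable blocks indexed by `ρ' ≠ τ'` changes `f` at most by a sign;
(b) `∂f/∂z_σ^{(h)} ≠ 0` for every `σ`;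
(c) for each `j`, `f` involves no `u_{σj}^{(k)}` iff `ξⱼ = 0`, and if `ξⱼ ≠ 0` then
`∂f/∂u_{σj}^{(h)} ≠ 0` for every `σ`. -/
theorem chow_form_symmetry_and_orders
    {E : Type*} [Field E] [CharZero E] (δ : E → E)
    (hδadd : ∀ a b : E, δ (a + b) = δ a + δ b)
    (hδmul : ∀ a b : E, δ (a * b) = a * δ b + δ a * b)
    (F : Subfield E) (hF : ∀ x ∈ F, δ x ∈ F)
    (n d h : ℕ) (hn : 1 ≤ n) (ξ : Fin n → E)
    (u : Fin (d + 1) → Fin n → E)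
    (hu : AlgebraicIndependent (diffAdjoin δ F (Set.range ξ))
      (fun p : (Fin (d + 1) × Fin n) × ℕ => δ^[p.2] (u p.1.1 p.1.2)))
    (ζ : Fin (d + 1) → E) (hζ : ∀ σ, ζ σ = -∑ ρ : Fin n, u σ ρ * ξ ρ)
    (ev : MvPolynomial
        ((Fin (d + 1) × Fin n × Fin (h + 1)) ⊕ (Fin (d + 1) × Fin (h + 1))) F →ₐ[F] E)
    (hev : ev = MvPolynomial.aeval
      (Sum.elim (fun q : Fin (d + 1) × Fin n × Fin (h + 1) => δ^[(q.2.2 : ℕ)] (u q.1 q.2.1))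
        (fun q : Fin (d + 1) × Fin (h + 1) => δ^[(q.2 : ℕ)] (ζ q.1))))
    (f : MvPolynomial
        ((Fin (d + 1) × Fin n × Fin (h + 1)) ⊕ (Fin (d + 1) × Fin (h + 1))) F)
    (hirr : Irreducible f) (hf : ev f = 0)
    (hdiv : ∀ g, ev g = 0 → f ∣ g)
    (hord : MvPolynomial.pderiv (Sum.inr (0, Fin.last h)) f ≠ 0) :
    (∀ ρ' τ' : Fin (d + 1), ρ' ≠ τ' →
        MvPolynomial.rename
          (Sum.map
            (fun q : Fin (d + 1) × Fin n × Fin (h + 1) => (Equiv.swap ρ' τ' q.1, q.2))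
            (fun q : Fin (d + 1) × Fin (h + 1) => (Equiv.swap ρ' τ' q.1, q.2))) f = f ∨
        MvPolynomial.rename
          (Sum.map
            (fun q : Fin (d + 1) × Fin n × Fin (h + 1) => (Equiv.swap ρ' τ' q.1, q.2))
            (fun q : Fin (d + 1) × Fin (h + 1) => (Equiv.swap ρ' τ' q.1, q.2))) f = -f) ∧
    (∀ σ : Fin (d + 1), MvPolynomial.pderiv (Sum.inr (σ, Fin.last h)) f ≠ 0) ∧
    (∀ j : Fin n,
      ((∀ σ : Fin (d + 1), ∀ k : Fin (h + 1),
          MvPolynomial.pderiv (Sum.inl (σ, j, k)) f = 0) ↔ ξ j = 0) ∧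
      (ξ j ≠ 0 → ∀ σ : Fin (d + 1),
          MvPolynomial.pderiv (Sum.inl (σ, j, Fin.last h)) f ≠ 0)) := by
  classical
  let D : Derivation ℤ E E :=
    Derivation.mk' (AddMonoidHom.mk' δ hδadd).toIntLinearMap fun a b => by
      simp only [AddMonoidHom.coe_toIntLinearMap, AddMonoidHom.mk'_apply, smul_eq_mul, hδmul]
      ring
  have hDδ : (D : E → E) = δ := rfl
  have hFK : F ≤ diffAdjoin δ F (Set.range ξ) := fun x hx =>
    Subfield.subset_closure (Or.inl hx)
  let η : Fin n → ℕ → diffAdjoin δ F (Set.range ξ) := fun j b =>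
    ⟨δ^[b] (ξ j), Subfield.subset_closure (Or.inr ⟨ξ j, ⟨j, rfl⟩, b, rfl⟩)⟩
  let Φ := ChowForm.genericEval d h (Subfield.inclusion hFK) η
  have hζk : ∀ σ (k : ℕ), δ^[k] (ζ σ) = -∑ ρ : Fin n, ∑ ij ∈ Finset.HasAntidiagonal.antidiagonal k,
      k.choose ij.1 • (δ^[ij.1] (u σ ρ) * δ^[ij.2] (ξ ρ)) := by
    intro σ k
    have hpow : ∀ x, δ^[k] x = ((D : E →ₗ[ℤ] E) ^ k) x := fun x => by
      rw [Module.End.pow_apply]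
      rfl
    rw [hζ, hpow, map_neg, map_sum]
    simp only [← hpow]
    simp only [← hDδ, ChowForm.iterate_mul]
  have hev_eq : ∀ g, ev g = MvPolynomial.aeval
      (fun p : (Fin (d + 1) × Fin n) × ℕ => δ^[p.2] (u p.1.1 p.1.2)) (Φ g) := by
    intro g
    rw [hev]
    induction g using MvPolynomial.induction_on with
    | C a =>
      simp only [Φ, ChowForm.genericEval, MvPolynomial.coe_eval₂Hom, MvPolynomial.eval₂_C,
        RingHom.comp_apply, MvPolynomial.aeval_C]
      rfl
    | add p q hp hq => simp only [map_add, hp, hq]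
    | mul_X p i hp =>
      simp only [map_mul, hp]
      congr 1
      rcases i with ⟨σ, j, k⟩ | ⟨σ, k⟩
      · simp [Φ, ChowForm.genericEval, ChowForm.genericPoint]
      · simp only [MvPolynomial.aeval_X, Sum.elim_inr, hζk, Φ, ChowForm.genericEval,
          ChowForm.genericPoint, MvPolynomial.eval₂Hom_X', map_neg, map_sum, map_nsmul, map_mul,
          MvPolynomial.aeval_C]
        rfl
  have hker : ∀ g, ev g = 0 ↔ Φ g = 0 := fun g => by
    rw [hev_eq]
    exact map_eq_zero_iff _ hu
  have hΦf : Φ f = 0 := (hker f).1 hf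
  have hpd : ∀ i, Φ (MvPolynomial.pderiv i f) = 0 → MvPolynomial.pderiv i f = 0 := fun i hi =>
    ChowForm.pderiv_eq_zero_of_dvd i (hdiv _ ((hker _).2 hi))
  have hsymm : ∀ ρ' τ' : Fin (d + 1),
      MvPolynomial.rename (ChowForm.blockPerm h n (Equiv.swap ρ' τ')) f = f ∨
        MvPolynomial.rename (ChowForm.blockPerm h n (Equiv.swap ρ' τ')) f = -f := by
    intro ρ' τ'
    refine ChowForm.rename_eq_or_eq_neg_of_dvd hirr.ne_zero _ ?_ (hdiv _ ((hker _).2 ?_))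
    · rintro (⟨σ, j, k⟩ | ⟨σ, k⟩) <;> simp [ChowForm.blockPerm]
    · rw [ChowForm.genericEval_rename_blockPerm]
      exact (congrArg _ hΦf).trans (map_zero _)
  have hz : ∀ σ : Fin (d + 1), MvPolynomial.pderiv (Sum.inr (σ, Fin.last h)) f ≠ 0 := by
    intro σ h0
    apply hord
    have hr := MvPolynomial.pderiv_rename
      (ChowForm.blockPerm h n (Equiv.swap 0 σ)).injective (Sum.inr (σ, Fin.last h)) f
    have hi : ChowForm.blockPerm h n (Equiv.swap 0 σ) (Sum.inr (σ, Fin.last h)) =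
        Sum.inr (0, Fin.last h) := by simp [ChowForm.blockPerm]
    rw [hi, h0, map_zero] at hr
    rcases hsymm 0 σ with hs | hs
    · rwa [hs] at hr
    · rwa [hs, map_neg, neg_eq_zero] at hr
  have hlast : ∀ j, ξ j ≠ 0 → ∀ σ : Fin (d + 1),
      MvPolynomial.pderiv (Sum.inl (σ, j, Fin.last h)) f ≠ 0 := by
    intro j hj σ h0
    have hc := ChowForm.pderiv_genericEval_last (Subfield.inclusion hFK) η σ j f
    rw [h0, show ChowForm.genericEval d h (Subfield.inclusion hFK) η f = 0 from hΦf, map_zero,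
      map_zero, zero_sub, eq_comm, neg_eq_zero, mul_eq_zero] at hc
    rcases hc with hc | hc
    · exact hz σ (hpd _ hc)
    · rw [MvPolynomial.C_eq_zero] at hc
      exact hj (congrArg Subtype.val hc)
  refine ⟨fun ρ' τ' _ => hsymm ρ' τ', hz, fun j => ⟨⟨fun hall => ?_, fun hj σ k => ?_⟩, hlast j⟩⟩
  · by_contra hj
    exact hlast j hj 0 (hall 0 _)
  · apply hpd
    have hη : ∀ b, η j b = 0 := fun b => Subtype.ext <| by
      change δ^[b] (ξ j) = 0
      rw [hj]
      exact Function.iterate_fixed (map_zero D) b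
    have hc := ChowForm.pderiv_genericEval_of_eq_zero (Subfield.inclusion hFK) η σ j hη k f
    rw [show ChowForm.genericEval d h (Subfield.inclusion hFK) η f = 0 from hΦf, map_zero] at hc
    exact hc.symm
end
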